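/- arXiv:2010.00671 — 4 statements merged into one kernel-verified Lean document; each statement's English description precedes it below -/
import Mathlib

section
/- The integral of ψ over [0,1] equals (48/π^4) · Σ_{n odd} sech²(nπ/2)/n^4, where the sum runs over odd positive integers n. That is, ∫_0^1 ψ(z) dz = (48/π^4) Σ_{n odd} sech²(nπ/2)/n^4. -/
/-- `a n = (4/n^4)·tanh(nπ/2) − π/n^3`. -/
noncomputable def a (n : ℕ) : ℝ :=
  4 / (n : ℝ) ^ 4 * Real.tanh ((n : ℝ) * Real.pi / 2) - Real.pi / (n : ℝ) ^ 3

/-- `ψ(z) = (24/π^4) · Σ_{n odd} a_n · sin(nπz)`, the sum over odd positive integers. -/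
noncomputable def psi (z : ℝ) : ℝ :=
  (24 / Real.pi ^ 4) * ∑' k : ℕ, a (2 * k + 1) * Real.sin ((2 * (k : ℝ) + 1) * Real.pi * z)

open Filter Topology

lemma aux_odd {f : ℕ → ℝ} {s e : ℝ} (hs : HasSum f s) (he : HasSum (fun k => f (2 * k)) e) :
    HasSum (fun k => f (2 * k + 1)) (s - e) := by
  have ho : Summable (fun k => f (2 * k + 1)) :=
    hs.summable.comp_injective (i := fun k : ℕ => 2 * k + 1) (fun x y h => by simpa using h)
  have h := tsum_even_add_odd he.summable ho
  rw [he.tsum_eq, hs.tsum_eq] at h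
  have : s - e = ∑' k, f (2 * k + 1) := by linarith
  rw [this]; exact ho.hasSum

lemma aux_coth {x : ℝ} (hx : 0 < x) :
    HasSum (fun n : ℕ => 2 * x / (x ^ 2 + (n : ℝ) ^ 2))
      (Real.pi * (Real.cosh (Real.pi * x) / Real.sinh (Real.pi * x)) + 1 / x) := by
  have hz : ((x : ℂ) * Complex.I) ∈ Complex.integerComplement := by
    rw [Complex.mem_integerComplement_iff]
    rintro ⟨n, hn⟩
    have := congrArg Complex.im hn
    simp at this
    exact hx.ne this
  have h1 : HasSum (fun n => cotTerm ((x : ℂ) * Complex.I) n)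
      (Real.pi * Complex.cot (Real.pi * (x * Complex.I)) - 1 / (x * Complex.I)) := by
    rw [cot_series_rep' hz]
    exact (summable_cotTerm hz).hasSum
  have h2 := h1.mul_left Complex.I
  have e1 : ∀ n : ℕ, Complex.I * cotTerm ((x : ℂ) * Complex.I) n
      = ((2 * x / (x ^ 2 + ((n + 1 : ℕ) : ℝ) ^ 2) : ℝ) : ℂ) := by
    intro n
    rw [cotTerm_identity hz]
    have hp : (x ^ 2 + ((n : ℝ) + 1) ^ 2) ≠ 0 := by positivity
    have hp' : ((x : ℂ) ^ 2 + ((n : ℂ) + 1) ^ 2) ≠ 0 := by exact_mod_cast hp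
    have : ((x : ℂ) * Complex.I + (n + 1)) * ((x : ℂ) * Complex.I - (n + 1))
        = - ((x : ℂ) ^ 2 + ((n : ℂ) + 1) ^ 2) := by
      ring_nf; rw [Complex.I_sq]; ring
    rw [this]
    push_cast
    field_simp
    rw [Complex.I_sq]
    ring
  have hs : Real.sinh (Real.pi * x) ≠ 0 := by
    have : 0 < Real.sinh (Real.pi * x) := Real.sinh_pos_iff.2 (by positivity)
    exact this.ne'
  have e2 : Complex.I * (Real.pi * Complex.cot (Real.pi * (x * Complex.I)) - 1 / (x * Complex.I))
      = ((Real.pi * (Real.cosh (Real.pi * x) / Real.sinh (Real.pi * x)) - 1 / x : ℝ) : ℂ) := by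
    have hs' : Complex.sinh (Real.pi * x) ≠ 0 := by exact_mod_cast hs
    have hx' : (x : ℂ) ≠ 0 := by exact_mod_cast hx.ne'
    rw [Complex.cot, ← mul_assoc, Complex.cos_mul_I, Complex.sin_mul_I]
    push_cast
    have hI := Complex.I_ne_zero
    field_simp
  rw [e2] at h2
  simp_rw [e1] at h2
  have h3 := Complex.hasSum_ofReal.1 h2
  have h4 := (hasSum_nat_add_iff (f := fun n : ℕ => 2 * x / (x ^ 2 + (n : ℝ) ^ 2)) 1).1 h3
  convert! h4 using 1
  simp
  field_simp
  ring

lemma aux_tanh_pos {x : ℝ} (hx : 0 < x) :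
    HasSum (fun k : ℕ => 2 * x / (x ^ 2 + (2 * (k : ℝ) + 1) ^ 2))
      (Real.pi / 2 * Real.tanh (Real.pi / 2 * x)) := by
  have h1 := aux_coth hx
  have h2 := (aux_coth (half_pos hx)).mul_left (1 / 2)
  have h3 := aux_odd (e := 1 / 2 * (Real.pi * (Real.cosh (Real.pi * (x / 2)) /
    Real.sinh (Real.pi * (x / 2))) + 1 / (x / 2))) h1 (by
      convert! h2 using 2 with k
      have : x ^ 2 + (2 * (k : ℝ)) ^ 2 ≠ 0 := by positivity
      have : (x / 2) ^ 2 + (k : ℝ) ^ 2 ≠ 0 := by positivity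
      push_cast
      field_simp)
  convert! h3 using 1
  · funext k; push_cast; rfl
  · have hs : Real.sinh (Real.pi / 2 * x) ≠ 0 := by
      have : 0 < Real.sinh (Real.pi / 2 * x) := Real.sinh_pos_iff.2 (by positivity)
      exact this.ne'
    have hc : Real.cosh (Real.pi / 2 * x) ≠ 0 := (Real.cosh_pos _).ne'
    rw [show Real.pi * (x / 2) = Real.pi / 2 * x by ring,
      show Real.pi * x = 2 * (Real.pi / 2 * x) by ring, Real.cosh_two_mul, Real.sinh_two_mul,
      Real.tanh_eq_sinh_div_cosh]
    field_simp
    ring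

lemma aux_zeta2 : HasSum (fun k : ℕ => 1 / (2 * (k : ℝ) + 1) ^ 2) (Real.pi ^ 2 / 8) := by
  have h2 := hasSum_zeta_two.mul_left (1 / 4)
  have h3 := aux_odd (e := 1 / 4 * (Real.pi ^ 2 / 6)) hasSum_zeta_two (by
    convert! h2 using 2 with k
    push_cast
    rw [mul_pow, one_div_mul_one_div]; norm_num)
  convert! h3 using 1
  · funext k; push_cast; rfl
  · ring

lemma aux_sech {x : ℝ} (hx : 0 < x) :
    HasSum (fun k : ℕ => 2 * ((2 * (k : ℝ) + 1) ^ 2 - x ^ 2) / (x ^ 2 + (2 * (k : ℝ) + 1) ^ 2) ^ 2)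
      ((Real.pi / 2) ^ 2 * (1 / Real.cosh (Real.pi / 2 * x)) ^ 2) := by
  have hu := (aux_zeta2.mul_left 2).summable
  have hb : ∀ (k : ℕ) (y : ℝ), ‖2 * ((2 * (k : ℝ) + 1) ^ 2 - y ^ 2) /
      (y ^ 2 + (2 * (k : ℝ) + 1) ^ 2) ^ 2‖ ≤ 2 * (1 / (2 * (k : ℝ) + 1) ^ 2) := by
    intro k y
    have hm : 0 < (2 * (k : ℝ) + 1) ^ 2 := by positivity
    have hy : 0 ≤ y ^ 2 := by positivity
    generalize (2 * (k : ℝ) + 1) ^ 2 = A at *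
    generalize y ^ 2 = B at *
    rw [Real.norm_eq_abs, abs_div, abs_mul, abs_two, abs_of_pos (by positivity : 0 < (B + A) ^ 2),
      mul_one_div, div_le_div_iff₀ (by positivity) hm]
    have : |A - B| ≤ B + A := abs_le.2 ⟨by linarith, by linarith⟩
    nlinarith [mul_le_mul this (by linarith : A ≤ B + A) hm.le (by positivity)]
  have hd := hasDerivAt_tsum_of_isPreconnected (t := Set.Ioi (0 : ℝ)) (y₀ := x) (y := x)
    (g := fun (k : ℕ) y => 2 * y / (y ^ 2 + (2 * (k : ℝ) + 1) ^ 2))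
    (g' := fun (k : ℕ) y => 2 * ((2 * (k : ℝ) + 1) ^ 2 - y ^ 2) /
      (y ^ 2 + (2 * (k : ℝ) + 1) ^ 2) ^ 2) hu isOpen_Ioi isPreconnected_Ioi
    (by
      intro k y hy
      have hne : y ^ 2 + (2 * (k : ℝ) + 1) ^ 2 ≠ 0 := by positivity
      have := ((hasDerivAt_id y).const_mul 2).div
        (((hasDerivAt_id y).pow 2).add_const ((2 * (k : ℝ) + 1) ^ 2)) hne
      convert! this using 1
      simp
      ring)
    (fun k y _ => hb k y) hx (aux_tanh_pos hx).summable hx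
  have hd2 : HasDerivAt (fun y => Real.pi / 2 * Real.tanh (Real.pi / 2 * y))
      ((Real.pi / 2) ^ 2 * (1 / Real.cosh (Real.pi / 2 * x)) ^ 2) x := by
    have hc : Real.cosh (Real.pi / 2 * x) ≠ 0 := (Real.cosh_pos _).ne'
    have hl : HasDerivAt (fun y : ℝ => Real.pi / 2 * y) (Real.pi / 2) x := by
      simpa using (hasDerivAt_id x).const_mul (Real.pi / 2)
    have := ((hl.sinh.div hl.cosh hc).const_mul (Real.pi / 2))
    simp_rw [Real.tanh_eq_sinh_div_cosh]
    convert! this using 1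
    have h := Real.cosh_sq (Real.pi / 2 * x)
    generalize Real.cosh (Real.pi / 2 * x) = C at *
    generalize Real.sinh (Real.pi / 2 * x) = S at *
    field_simp
    linarith
  have hd3 := hd2.congr_of_eventuallyEq (f₁ := fun y => ∑' k : ℕ, 2 * y / (y ^ 2 + (2 * (k : ℝ) + 1) ^ 2)) (by
    filter_upwards [isOpen_Ioi.mem_nhds hx] with y hy
    exact (aux_tanh_pos hy).tsum_eq)
  rw [hd3.unique hd]
  exact (Summable.of_norm_bounded hu (fun k => hb k x)).hasSum

/-- The symmetrizable double series term. -/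
noncomputable def auxH (p : ℕ × ℕ) : ℝ :=
  8 / Real.pi ^ 2 * (((2 * (p.2 : ℝ) + 1) ^ 2 + 3 * (2 * (p.1 : ℝ) + 1) ^ 2) /
    ((2 * (p.1 : ℝ) + 1) ^ 4 * ((2 * (p.1 : ℝ) + 1) ^ 2 + (2 * (p.2 : ℝ) + 1) ^ 2) ^ 2))

lemma aux_row (k : ℕ) : HasSum (fun m => auxH (k, m))
    (4 * Real.tanh ((2 * (k : ℝ) + 1) * Real.pi / 2) / (Real.pi * (2 * (k : ℝ) + 1) ^ 5)
      - (1 / Real.cosh ((2 * (k : ℝ) + 1) * Real.pi / 2)) ^ 2 / (2 * (k : ℝ) + 1) ^ 4) := by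
  have hx : 0 < 2 * (k : ℝ) + 1 := by positivity
  have h1 := (aux_tanh_pos hx).mul_left (8 / (Real.pi ^ 2 * (2 * (k : ℝ) + 1) ^ 5))
  have h2 := (aux_sech hx).mul_left (4 / (Real.pi ^ 2 * (2 * (k : ℝ) + 1) ^ 4))
  have hpi := Real.pi_pos
  convert! h1.sub h2 using 1
  · funext m
    unfold auxH
    have : (2 * (k : ℝ) + 1) ^ 2 + (2 * (m : ℝ) + 1) ^ 2 ≠ 0 := by positivity
    field_simp
    ring
  · rw [show (2 * (k : ℝ) + 1) * Real.pi / 2 = Real.pi / 2 * (2 * (k : ℝ) + 1) by ring]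
    have hc : Real.cosh (Real.pi / 2 * (2 * (k : ℝ) + 1)) ≠ 0 := (Real.cosh_pos _).ne'
    field_simp
    ring

lemma aux_summ4 : Summable (fun k : ℕ => 1 / (2 * (k : ℝ) + 1) ^ 4) := by
  refine Summable.of_nonneg_of_le (fun k => by positivity) (fun k => ?_) aux_zeta2.summable
  have : (1 : ℝ) ≤ 2 * (k : ℝ) + 1 := by have := k.cast_nonneg (α := ℝ); linarith
  exact one_div_le_one_div_of_le (by positivity) (pow_le_pow_right₀ this (by norm_num))

lemma aux_prod : HasSum (fun p : ℕ × ℕ => 1 / (2 * (p.1 : ℝ) + 1) ^ 4 * (1 / (2 * (p.2 : ℝ) + 1) ^ 2))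
    ((∑' k : ℕ, 1 / (2 * (k : ℝ) + 1) ^ 4) * (Real.pi ^ 2 / 8)) := by
  have hs := Summable.mul_of_nonneg aux_summ4 aux_zeta2.summable
    (fun k => by simp only [Pi.zero_apply]; positivity)
    (fun k => by simp only [Pi.zero_apply]; positivity)
  have h := HasSum.mul aux_summ4.hasSum aux_zeta2 hs
  exact h

lemma aux_H : HasSum auxH (∑' k : ℕ, 1 / (2 * (k : ℝ) + 1) ^ 4) := by
  have hpi := Real.pi_pos
  have hsum : Summable auxH := by
    refine Summable.of_nonneg_of_le (fun p => by unfold auxH; positivity) (fun p => ?_)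
      (aux_prod.summable.mul_left (8 / Real.pi ^ 2 * 3))
    unfold auxH
    rw [mul_assoc]
    refine mul_le_mul_of_nonneg_left ?_ (by positivity)
    rw [one_div_mul_one_div, mul_one_div, div_le_div_iff₀ (by positivity) (by positivity)]
    have hA : 0 < (2 * (p.1 : ℝ) + 1) ^ 2 := by positivity
    have hB : 0 < (2 * (p.2 : ℝ) + 1) ^ 2 := by positivity
    rw [show (2 * (p.1 : ℝ) + 1) ^ 4 = ((2 * (p.1 : ℝ) + 1) ^ 2) ^ 2 by ring]
    generalize (2 * (p.1 : ℝ) + 1) ^ 2 = A at *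
    generalize (2 * (p.2 : ℝ) + 1) ^ 2 = B at *
    have : 3 * (A ^ 2 * (A + B) ^ 2) - (B + 3 * A) * (A ^ 2 * B)
      = A ^ 2 * (3 * A ^ 2 + 3 * A * B + 2 * B ^ 2) := by ring
    have : 0 < A ^ 2 * (3 * A ^ 2 + 3 * A * B + 2 * B ^ 2) := by positivity
    linarith
  have h1 := hsum.hasSum
  have h2 := (Equiv.prodComm ℕ ℕ).hasSum_iff.2 h1
  have h3 := aux_prod
  have h4 := (Equiv.prodComm ℕ ℕ).hasSum_iff.2 h3
  have h5 := (h3.add h4).mul_left (8 / Real.pi ^ 2)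
  have h6 := h1.add h2
  have : ∑' p, auxH p = ∑' k : ℕ, 1 / (2 * (k : ℝ) + 1) ^ 4 := by
    have h7 := h6.unique (by
      convert! h5 using 1
      funext p
      simp only [auxH, Function.comp, Equiv.prodComm_apply, Prod.fst_swap, Prod.snd_swap]
      have hA : 0 < (2 * (p.1 : ℝ) + 1) := by positivity
      have hB : 0 < (2 * (p.2 : ℝ) + 1) := by positivity
      generalize (2 * (p.1 : ℝ) + 1) = A at *
      generalize (2 * (p.2 : ℝ) + 1) = B at *
      rw [add_comm (B ^ 2) (A ^ 2), ← mul_add]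
      have : A ^ 2 + B ^ 2 ≠ 0 := by positivity
      field_simp
      ring)
    field_simp at h7
    linarith
  rw [← this]; exact h1

lemma aux_a (k : ℕ) : ‖a (2 * k + 1)‖ ≤ 8 * (1 / (2 * (k : ℝ) + 1) ^ 2) := by
  unfold a
  push_cast
  have h1 : (1 : ℝ) ≤ 2 * (k : ℝ) + 1 := by have := k.cast_nonneg (α := ℝ); linarith
  generalize 2 * (k : ℝ) + 1 = n at *
  have hn : 0 < n := by linarith
  have ht : |Real.tanh (n * Real.pi / 2)| ≤ 1 := (Real.abs_tanh_lt_one _).le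
  have e4 : 1 / n ^ 4 ≤ 1 / n ^ 2 :=
    one_div_le_one_div_of_le (by positivity) (pow_le_pow_right₀ h1 (by norm_num))
  have e3 : 1 / n ^ 3 ≤ 1 / n ^ 2 :=
    one_div_le_one_div_of_le (by positivity) (pow_le_pow_right₀ h1 (by norm_num))
  have p3 : 0 < 1 / n ^ 3 := by positivity
  have p4 : 0 < 1 / n ^ 4 := by positivity
  calc _ ≤ ‖4 / n ^ 4 * Real.tanh (n * Real.pi / 2)‖ + ‖Real.pi / n ^ 3‖ := norm_sub_le _ _
    _ = 4 * (1 / n ^ 4) * |Real.tanh (n * Real.pi / 2)| + Real.pi * (1 / n ^ 3) := by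
      rw [norm_mul, Real.norm_of_nonneg (by positivity : 0 ≤ 4 / n ^ 4),
        Real.norm_of_nonneg (by positivity : 0 ≤ Real.pi / n ^ 3), Real.norm_eq_abs]; ring
    _ ≤ 4 * (1 / n ^ 4) * 1 + 4 * (1 / n ^ 3) := by
      gcongr; exact Real.pi_le_four
    _ ≤ _ := by linarith

lemma aux_int (k : ℕ) : ∫ z in (0:ℝ)..1, a (2 * k + 1) * Real.sin ((2 * (k : ℝ) + 1) * Real.pi * z)
    = 2 * (4 * Real.tanh ((2 * (k : ℝ) + 1) * Real.pi / 2) / (Real.pi * (2 * (k : ℝ) + 1) ^ 5)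
      - 1 / (2 * (k : ℝ) + 1) ^ 4) := by
  have hpi := Real.pi_pos
  have hn : 0 < 2 * (k : ℝ) + 1 := by positivity
  have hc : Real.cos ((2 * (k : ℝ) + 1) * Real.pi) = -1 := by
    rw [show (2 * (k : ℝ) + 1) * Real.pi = Real.pi + k * (2 * Real.pi) by ring,
      Real.cos_add_nat_mul_two_pi, Real.cos_pi]
  rw [intervalIntegral.integral_const_mul,
    intervalIntegral.integral_comp_mul_left (fun y => Real.sin y) (by positivity), integral_sin]
  simp only [mul_zero, mul_one, Real.cos_zero, hc, a, smul_eq_mul]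
  push_cast
  field_simp
  ring

/-- `∫_0^1 ψ(z) dz = (48/π^4) Σ_{n odd} sech²(nπ/2)/n^4`. -/
theorem integral_psi_eq :
    ∫ z in (0:ℝ)..1, psi z =
      (48 / Real.pi ^ 4) *
        ∑' k : ℕ, (1 / Real.cosh ((2 * (k : ℝ) + 1) * Real.pi / 2)) ^ 2
          / (2 * (k : ℝ) + 1) ^ 4 := by
  have hu := (aux_zeta2.mul_left 8).summable
  have hb : ∀ (k : ℕ) (z : ℝ), ‖a (2 * k + 1) * Real.sin ((2 * (k : ℝ) + 1) * Real.pi * z)‖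
      ≤ 8 * (1 / (2 * (k : ℝ) + 1) ^ 2) := by
    intro k z
    rw [norm_mul]
    exact (mul_le_of_le_one_right (norm_nonneg _) (Real.abs_sin_le_one _)).trans (aux_a k)
  have hint := intervalIntegral.hasSum_integral_of_dominated_convergence
    (μ := MeasureTheory.volume) (a := (0 : ℝ)) (b := 1)
    (F := fun (k : ℕ) z => a (2 * k + 1) * Real.sin ((2 * (k : ℝ) + 1) * Real.pi * z))
    (f := fun z => ∑' k : ℕ, a (2 * k + 1) * Real.sin ((2 * (k : ℝ) + 1) * Real.pi * z))
    (fun k _ => 8 * (1 / (2 * (k : ℝ) + 1) ^ 2))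
    (fun k => (by fun_prop : Continuous _).aestronglyMeasurable)
    (fun k => Eventually.of_forall fun z _ => hb k z)
    (Eventually.of_forall fun z _ => hu)
    intervalIntegrable_const
    (Eventually.of_forall fun z _ => (Summable.of_norm_bounded hu (fun k => hb k z)).hasSum)
  simp_rw [aux_int] at hint
  have hrow := aux_H.prod_fiberwise aux_row
  have hQ := aux_summ4.hasSum
  have h := ((hint.div_const 2).add hQ).sub hrow
  have hf := h.tsum_eq
  have he : ∀ k : ℕ, 2 * (4 * Real.tanh ((2 * (k : ℝ) + 1) * Real.pi / 2) /
      (Real.pi * (2 * (k : ℝ) + 1) ^ 5) - 1 / (2 * (k : ℝ) + 1) ^ 4) / 2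
      + 1 / (2 * (k : ℝ) + 1) ^ 4
      - (4 * Real.tanh ((2 * (k : ℝ) + 1) * Real.pi / 2) / (Real.pi * (2 * (k : ℝ) + 1) ^ 5)
      - (1 / Real.cosh ((2 * (k : ℝ) + 1) * Real.pi / 2)) ^ 2 / (2 * (k : ℝ) + 1) ^ 4)
      = (1 / Real.cosh ((2 * (k : ℝ) + 1) * Real.pi / 2)) ^ 2 / (2 * (k : ℝ) + 1) ^ 4 := by
    intro k; ring
  rw [tsum_congr he] at hf
  rw [hf]
  unfold psi
  rw [intervalIntegral.integral_const_mul]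
  ring
end

section
/- The identity 4 · Σ_{n odd} tanh(nπ/2)/n^5 = π^5/96 + π · Σ_{n odd} sech²(nπ/2)/n^4 holds, where both sums run over odd positive integers n. -/
open Real

lemma sum_all (x : ℝ) (hx : 0 < x) :
    HasSum (fun n : ℕ => 1 / (((n:ℝ)+1)^2 + x^2)) ((π * (cosh (π*x) / sinh (π*x)) - 1/x) / (2*x)) := by
  have hz : ((x:ℂ) * Complex.I) ∈ Complex.integerComplement := by
    rintro ⟨n, hn⟩
    have := congrArg Complex.im hn
    simp at this
    exact hx.ne this
  have h1 := cot_series_rep' hz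
  have h2 := summable_cotTerm hz
  have h3 : HasSum (fun n : ℕ => 1 / ((x:ℂ) * Complex.I - (n + 1)) + 1 / ((x:ℂ) * Complex.I + (n + 1))) _ := h2.hasSum
  have h4 := h1
  rw [h3.tsum_eq] at h4
  rw [← h4] at h3
  rw [← Complex.hasSum_ofReal]
  have hxc : (x:ℂ) ≠ 0 := by exact_mod_cast hx.ne'
  have hs : Complex.sinh (π*x) ≠ 0 := by
    rw [← Complex.ofReal_mul, ← Complex.ofReal_sinh]
    exact_mod_cast (Real.sinh_pos_iff.mpr (by positivity)).ne'
  convert! h3.mul_left (Complex.I / (2*x)) using 1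
  · funext n
    have h5 : ((n:ℂ)+1)^2 + x^2 ≠ 0 := by
      have : ((n:ℝ)+1)^2 + x^2 ≠ 0 := by positivity
      exact_mod_cast this
    have h6 : (x:ℂ) * Complex.I - (n + 1) ≠ 0 := by
      intro h
      have := congrArg Complex.im h
      simp at this
      exact hx.ne' this
    have h7 : (x:ℂ) * Complex.I + (n + 1) ≠ 0 := by
      intro h
      have := congrArg Complex.im h
      simp at this
      exact hx.ne' this
    push_cast
    rw [div_add_div _ _ h6 h7, div_mul_div_comm, div_eq_div_iff h5 (by simp [*])]
    linear_combination (-2*x*(n+1)^2) * Complex.I_sq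
  · have h8 : ((π:ℂ) * (x * Complex.I)) = (π*x) * Complex.I := by ring
    rw [h8, Complex.cot, Complex.cos_mul_I, Complex.sin_mul_I]
    push_cast
    field_simp
    

lemma sum_odd (x : ℝ) (hx : 0 < x) :
    HasSum (fun n : ℕ => 1 / ((2*(n:ℝ)+1)^2 + x^2)) (π * tanh (x * π / 2) / (4*x)) := by
  have h1 := sum_all x hx
  have h2 := (sum_all (x/2) (by positivity)).mul_left (1/4)
  have hO : Summable (fun n : ℕ => 1 / ((2*(n:ℝ)+1)^2 + x^2)) := by
    have := h1.summable.comp_injective (i := fun n : ℕ => 2*n) (fun a b h => by simpa using h)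
    refine this.congr fun n => ?_
    simp
  have h3 : HasSum (fun n : ℕ => 1 / ((((2*n:ℕ):ℝ)+1)^2 + x^2)) (∑' n : ℕ, 1 / ((2*(n:ℝ)+1)^2 + x^2)) := by simpa using hO.hasSum
  have h4 : HasSum (fun n : ℕ => 1 / ((((2*n+1:ℕ):ℝ)+1)^2 + x^2)) (1 / 4 * ((π * (cosh (π*(x/2)) / sinh (π*(x/2))) - 1/(x/2)) / (2*(x/2)))) := by
    convert! h2 using 2 with n
    have : (0:ℝ) < ((n:ℝ)+1)^2 + (x/2)^2 := by positivity
    have : (0:ℝ) < (((2*n+1:ℕ):ℝ)+1)^2 + x^2 := by positivity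
    push_cast at *
    field_simp
    ring
  have h5 := (h3.even_add_odd (f := fun n : ℕ => 1 / (((n:ℝ)+1)^2 + x^2)) h4).unique h1
  convert hO.hasSum using 1
  rw [← eq_sub_iff_add_eq] at h5
  rw [h5]
  have hd : π * x = 2 * (π * (x/2)) := by ring
  rw [hd, cosh_two_mul, sinh_two_mul, tanh_eq_sinh_div_cosh, show x * π / 2 = π * (x/2) by ring]
  have hs : 0 < sinh (π * (x/2)) := Real.sinh_pos_iff.mpr (by positivity)
  have hc := cosh_pos (π * (x/2))
  field_simp
  ring

lemma sq_odd (x : ℝ) (hx : 0 < x) :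
    HasSum (fun n : ℕ => ((2*(n:ℝ)+1)^2 - x^2) / ((2*(n:ℝ)+1)^2 + x^2)^2)
      (π^2 / 8 * (1 / cosh (x * π / 2))^2) := by
  have hu : Summable (fun n : ℕ => 1 / (2*(n:ℝ)+1)^2) := by
    have := ((Real.summable_one_div_nat_pow (p := 2)).mpr (by norm_num)).comp_injective
      (i := fun n : ℕ => 2*n+1) (fun a b h => by simpa using h)
    refine this.congr fun n => ?_
    simp
  have hb : ∀ (n : ℕ) (y : ℝ), ‖((2*(n:ℝ)+1)^2 - y^2) / ((2*(n:ℝ)+1)^2 + y^2)^2‖ ≤ 1 / (2*(n:ℝ)+1)^2 := by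
    intro n y
    have hm : (0:ℝ) < (2*(n:ℝ)+1)^2 := by positivity
    generalize (2*(n:ℝ)+1)^2 = m at hm
    have hy := sq_nonneg y
    generalize y^2 = t at hy
    rw [Real.norm_eq_abs, abs_div, abs_of_pos (show 0 < (m+t)^2 by positivity), div_le_div_iff₀ (by positivity) hm]
    have : |m - t| ≤ m + t := by rw [abs_le]; constructor <;> linarith
    nlinarith [mul_nonneg hm.le hy]
  have hd : ∀ (n : ℕ) (y : ℝ), HasDerivAt (fun y : ℝ => y / ((2*(n:ℝ)+1)^2 + y^2))
      (((2*(n:ℝ)+1)^2 - y^2) / ((2*(n:ℝ)+1)^2 + y^2)^2) y := by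
    intro n y
    have h0 : (2*(n:ℝ)+1)^2 + y^2 ≠ 0 := by positivity
    have := (hasDerivAt_id y).div (((hasDerivAt_id y).pow 2).const_add ((2*(n:ℝ)+1)^2)) h0
    convert! this using 1
    simp
    ring
  have h1 := hasDerivAt_tsum hu hd hb (y₀ := 0) (by simp [summable_zero]) x
  have h2 : HasDerivAt (fun y : ℝ => π / 4 * (sinh (y * π / 2) / cosh (y * π / 2)))
      (π^2 / 8 * (1 / cosh (x * π / 2))^2) x := by
    have hl : HasDerivAt (fun y : ℝ => y * π / 2) (π/2) x := by
      simpa using ((hasDerivAt_id x).mul_const π).div_const 2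
    have := ((hl.sinh.div hl.cosh (cosh_pos _).ne').const_mul (π/4))
    convert! this using 1
    have hc := cosh_pos (x * π / 2)
    have h9 := cosh_sq (x * π / 2)
    clear this hl
    generalize x * π / 2 = w at *
    field_simp
    linear_combination (-8) * h9
  have h3 : (fun y : ℝ => ∑' n : ℕ, y / ((2*(n:ℝ)+1)^2 + y^2)) =ᶠ[nhds x]
      (fun y : ℝ => π / 4 * (sinh (y * π / 2) / cosh (y * π / 2))) := by
    filter_upwards [lt_mem_nhds hx] with y hy
    have := (sum_odd y hy).mul_left y
    rw [← tanh_eq_sinh_div_cosh]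
    convert! this.tsum_eq using 1
    · simp [div_eq_mul_inv]
    · field_simp
  have h4 := (h2.congr_of_eventuallyEq h3).unique h1
  rw [h4]
  exact (Summable.of_norm_bounded hu (fun n => hb n x)).hasSum

lemma odd_part (p : ℕ) (hp : 1 < p) (s : ℝ) (h : HasSum (fun n : ℕ => (1:ℝ) / (n:ℝ)^p) s) :
    HasSum (fun n : ℕ => 1 / (2*(n:ℝ)+1)^p) (s - s / 2^p) := by
  have hO : Summable (fun n : ℕ => 1 / (2*(n:ℝ)+1)^p) := by
    have := h.summable.comp_injective (i := fun n : ℕ => 2*n+1) (fun a b h => by simpa using h)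
    refine this.congr fun n => ?_
    simp
  have h3 : HasSum (fun n : ℕ => 1 / ((2*n+1:ℕ):ℝ)^p) (∑' n : ℕ, 1 / (2*(n:ℝ)+1)^p) := by
    simpa using hO.hasSum
  have h4 : HasSum (fun n : ℕ => 1 / ((2*n:ℕ):ℝ)^p) (s / 2^p) := by
    convert! h.div_const (2^p) using 2 with n
    push_cast
    rw [mul_pow, div_div, mul_comm]
  have h5 := (h4.even_add_odd (f := fun n : ℕ => (1:ℝ) / (n:ℝ)^p) h3).unique h
  rw [← eq_sub_iff_add_eq'] at h5
  rw [← h5]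
  exact hO.hasSum

theorem tanh_sech_identity_five :
    4 * ∑' k : ℕ, Real.tanh ((2 * (k : ℝ) + 1) * Real.pi / 2) / (2 * (k : ℝ) + 1) ^ 5
      = Real.pi ^ 5 / 96 +
        Real.pi * ∑' k : ℕ,
          (1 / Real.cosh ((2 * (k : ℝ) + 1) * Real.pi / 2)) ^ 2 / (2 * (k : ℝ) + 1) ^ 4 := by
  have z2 := odd_part 2 (by norm_num) _ hasSum_zeta_two
  have z4 := odd_part 4 (by norm_num) _ hasSum_zeta_four
  obtain ⟨o, ho⟩ : ∃ o : ℕ → ℝ, o = fun k : ℕ => 2 * (k:ℝ) + 1 := ⟨_, rfl⟩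
  have hpos : ∀ k, 0 < o k := by intro k; rw [ho]; positivity
  have eo : ∀ k : ℕ, 2 * (k:ℝ) + 1 = o k := by intro k; rw [ho]
  have t1 := fun k => sum_odd (o k) (hpos k)
  have t2 := fun k => sq_odd (o k) (hpos k)
  simp only [eo] at z2 z4 t1 t2 ⊢
  have hc : Summable (fun q : ℕ × ℕ => 1 / o q.1 ^ 4 * (1 / o q.2 ^ 2)) :=
    z4.summable.mul_of_nonneg z2.summable (fun k => by have := hpos k; positivity)
      (fun k => by have := hpos k; positivity)
  have hC := (z4.mul z2 hc).tsum_eq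
  have ha : Summable (fun q : ℕ × ℕ => 1 / o q.1 ^ 4 * (1 / (o q.2 ^ 2 + o q.1 ^ 2))) := by
    refine Summable.of_nonneg_of_le (fun q => ?_) (fun q => ?_) hc
    · have := hpos q.1; have := hpos q.2; positivity
    · have := hpos q.1; have := hpos q.2
      gcongr
      nlinarith
  have hb : Summable (fun q : ℕ × ℕ => 1 / (o q.1 ^ 2 * (o q.2 ^ 2 + o q.1 ^ 2) ^ 2)) := by
    refine Summable.of_nonneg_of_le (fun q => ?_) (fun q => ?_) hc
    · have := hpos q.1; have := hpos q.2; positivity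
    · have h1 := hpos q.1; have h2 := hpos q.2
      rw [← one_div_mul_one_div_rev, one_div_mul_one_div_rev, one_div_mul_one_div_rev]
      apply one_div_le_one_div_of_le (by positivity)
      have : o q.2 ^ 2 * o q.1 ^ 2 ≤ (o q.2 ^ 2 + o q.1 ^ 2) ^ 2 := by
        nlinarith [sq_nonneg (o q.2), sq_nonneg (o q.1), mul_pos (pow_pos h1 2) (pow_pos h2 2), sq_nonneg (o q.2 ^ 2), sq_nonneg (o q.1 ^ 2)]
      nlinarith [mul_le_mul_of_nonneg_left this (sq_nonneg (o q.1))]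
  have e1 : ∑' k : ℕ, tanh (o k * π / 2) / o k ^ 5 =
      4 / π * ∑' q : ℕ × ℕ, 1 / o q.1 ^ 4 * (1 / (o q.2 ^ 2 + o q.1 ^ 2)) := by
    rw [ha.tsum_prod, ← tsum_mul_left]
    refine tsum_congr fun k => ?_
    simp only
    rw [tsum_mul_left, (t1 k).tsum_eq]
    have := hpos k
    field_simp
  have hab := ha.sub (hb.mul_left 2)
  have e2 : ∑' k : ℕ, (1 / cosh (o k * π / 2)) ^ 2 / o k ^ 4 =
      8 / π ^ 2 * ((∑' q : ℕ × ℕ, 1 / o q.1 ^ 4 * (1 / (o q.2 ^ 2 + o q.1 ^ 2))) -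
        2 * ∑' q : ℕ × ℕ, 1 / (o q.1 ^ 2 * (o q.2 ^ 2 + o q.1 ^ 2) ^ 2)) := by
    rw [← tsum_mul_left (a := (2:ℝ)), ← ha.tsum_sub (hb.mul_left 2), hab.tsum_prod, ← tsum_mul_left]
    refine tsum_congr fun k => ?_
    have h0 := hpos k
    have : ∀ j : ℕ, 1 / o k ^ 4 * (1 / (o j ^ 2 + o k ^ 2)) - 2 * (1 / (o k ^ 2 * (o j ^ 2 + o k ^ 2) ^ 2))
        = 1 / o k ^ 4 * ((o j ^ 2 - o k ^ 2) / (o j ^ 2 + o k ^ 2) ^ 2) := by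
      intro j
      have := hpos j
      field_simp
      ring
    simp only [this]
    rw [tsum_mul_left, (t2 k).tsum_eq]
    have := cosh_pos (o k * π / 2)
    field_simp
  have key : (∑' q : ℕ × ℕ, 1 / o q.1 ^ 4 * (1 / (o q.2 ^ 2 + o q.1 ^ 2))) +
        2 * ∑' q : ℕ × ℕ, 1 / (o q.1 ^ 2 * (o q.2 ^ 2 + o q.1 ^ 2) ^ 2) =
        ∑' q : ℕ × ℕ, 1 / o q.1 ^ 4 * (1 / o q.2 ^ 2) := by
    have hd := ha.add (hb.mul_left 2)
    rw [← tsum_mul_left (a := (2:ℝ)), ← ha.tsum_add (hb.mul_left 2)]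
    have s1 := (Equiv.prodComm ℕ ℕ).tsum_eq (fun q : ℕ × ℕ => 1 / o q.1 ^ 4 * (1 / o q.2 ^ 2))
    have s2 := (Equiv.prodComm ℕ ℕ).tsum_eq (fun q : ℕ × ℕ => 1 / o q.1 ^ 4 * (1 / (o q.2 ^ 2 + o q.1 ^ 2)) + 2 * (1 / (o q.1 ^ 2 * (o q.2 ^ 2 + o q.1 ^ 2) ^ 2)))
    have hc' := (Equiv.prodComm ℕ ℕ).summable_iff.mpr hc
    have hd' := (Equiv.prodComm ℕ ℕ).summable_iff.mpr hd
    have s3 := hc.tsum_add hc'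
    have s4 := hd.tsum_add hd'
    simp only [Function.comp_def, Equiv.prodComm_apply, Prod.fst_swap, Prod.snd_swap] at s1 s2 s3 s4
    rw [s1] at s3
    rw [s2] at s4
    have : ∀ q : ℕ × ℕ, (1 / o q.1 ^ 4 * (1 / (o q.2 ^ 2 + o q.1 ^ 2)) + 2 * (1 / (o q.1 ^ 2 * (o q.2 ^ 2 + o q.1 ^ 2) ^ 2)))
       + (1 / o q.2 ^ 4 * (1 / (o q.1 ^ 2 + o q.2 ^ 2)) + 2 * (1 / (o q.2 ^ 2 * (o q.1 ^ 2 + o q.2 ^ 2) ^ 2)))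
       = 1 / o q.1 ^ 4 * (1 / o q.2 ^ 2) + 1 / o q.2 ^ 4 * (1 / o q.1 ^ 2) := by
      intro q
      have h1 := hpos q.1; have h2 := hpos q.2
      rw [add_comm (o q.2 ^ 2) (o q.1 ^ 2)]
      field_simp
      ring
    rw [tsum_congr this, s3] at s4
    linarith
  rw [hC] at key
  rw [e1, e2]
  have hpi := pi_pos
  generalize (∑' q : ℕ × ℕ, 1 / o q.1 ^ 4 * (1 / (o q.2 ^ 2 + o q.1 ^ 2))) = A at *
  generalize (∑' q : ℕ × ℕ, 1 / (o q.1 ^ 2 * (o q.2 ^ 2 + o q.1 ^ 2) ^ 2)) = B at *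
  have : A = (π ^ 4 / 90 - π ^ 4 / 90 / 2 ^ 4) * (π ^ 2 / 6 - π ^ 2 / 6 / 2 ^ 2) - 2 * B := by linarith
  rw [this]
  field_simp
  ring
end

section
/- Let m_k := ∫_0^1 z^k φ_0(z) dz denote the k-th moment of the density φ_0. Then m_1 = 1/2, m_2 = 1/2 − 1/(60μ), m_3 = 1/2 − 1/(40μ), and m_4 = 1/2 − 11/(280μ) + (576/(μπ^8)) · Σ_{n odd} sech²(nπ/2)/n^8, where the last sum runs over odd positive integers n. -/
/-- `μ = (48/π^4) Σ_{n odd} sech²(nπ/2)/n^4`. -/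
noncomputable def mu : ℝ :=
  (48 / Real.pi ^ 4) *
    ∑' k : ℕ, (1 / Real.cosh ((2 * (k : ℝ) + 1) * Real.pi / 2)) ^ 2 / (2 * (k : ℝ) + 1) ^ 4

/-- The splitting density `φ_0 = ψ/μ`. -/
noncomputable def phi0 (z : ℝ) : ℝ := psi z / mu

/-- The `k`-th moment `m_k = ∫_0^1 z^k φ_0(z) dz`. -/
noncomputable def m (k : ℕ) : ℝ := ∫ z in (0:ℝ)..1, z ^ k * phi0 z

/-! ### Partial fractions of `tanh` and `sech²` -/

theorem odd_pos' (k : ℕ) : (0:ℝ) < 2 * (k:ℝ) + 1 := by positivity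

theorem odd_ge (k : ℕ) : (1:ℝ) ≤ 2 * (k:ℝ) + 1 := by
  have : (0:ℝ) ≤ k := Nat.cast_nonneg k
  linarith

/-- Partial fractions for `coth`. -/
theorem coth_hasSum {x : ℝ} (hx : 0 < x) :
    HasSum (fun n : ℕ => 2 * x / (((n:ℝ) + 1) ^ 2 + x ^ 2))
      (Real.pi * (Real.cosh (Real.pi * x) / Real.sinh (Real.pi * x)) - 1 / x) := by
  have hz : (x * Complex.I : ℂ) ∈ Complex.integerComplement := by
    rw [Complex.mem_integerComplement_iff]
    rintro ⟨n, hn⟩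
    have := congrArg Complex.im hn
    simp at this
    exact hx.ne this
  have h1 := cot_series_rep' hz
  have hs : Summable (fun n : ℕ => 2 * x / (((n:ℝ) + 1) ^ 2 + x ^ 2)) := by
    have h2 : Summable (fun n : ℕ => 2 * x * (1 / ((n + 1 : ℕ) : ℝ) ^ 2)) := by
      apply Summable.mul_left
      exact (summable_nat_add_iff 1).2 (Real.summable_one_div_nat_pow.2 (by norm_num))
    refine h2.of_nonneg_of_le (fun n => by positivity) (fun n => ?_)
    rw [mul_one_div]
    push_cast
    gcongr
    nlinarith [sq_nonneg x]
  refine hs.hasSum_iff.2 ?_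
  have h3 : ∀ n : ℕ, (1 / ((x * Complex.I : ℂ) - (n + 1)) + 1 / ((x * Complex.I : ℂ) + (n + 1)))
      = -Complex.I * ((2 * x / (((n:ℝ) + 1) ^ 2 + x ^ 2) : ℝ) : ℂ) := by
    intro n
    have e1 : (x * Complex.I : ℂ) - (n + 1) ≠ 0 := by
      intro h
      have := congrArg Complex.im h
      simp at this
      exact hx.ne' this
    have e2 : (x * Complex.I : ℂ) + (n + 1) ≠ 0 := by
      intro h
      have := congrArg Complex.im h
      simp at this
      exact hx.ne' this
    have e3 : (((n:ℂ) + 1) ^ 2 + (x:ℂ) ^ 2) ≠ 0 := by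
      have : ((n:ℝ) + 1) ^ 2 + x ^ 2 ≠ 0 := by positivity
      exact_mod_cast this
    push_cast
    field_simp
    ring_nf
    simp only [show Complex.I ^ 3 = -Complex.I by rw [pow_succ, Complex.I_sq]; ring]
    ring
  simp_rw [h3] at h1
  rw [tsum_mul_left, ← Complex.ofReal_tsum] at h1
  rw [Complex.cot_eq_cos_div_sin, ← mul_assoc, Complex.cos_mul_I, Complex.sin_mul_I] at h1
  have hsinh : Real.sinh (Real.pi * x) ≠ 0 := (Real.sinh_pos_iff.2 (by positivity)).ne'
  have hsinh' : Complex.sinh (Real.pi * x) ≠ 0 := by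
    exact_mod_cast hsinh
  have hxc : (x:ℂ) ≠ 0 := by exact_mod_cast hx.ne'
  have h4 : ((∑' n : ℕ, 2 * x / (((n:ℝ) + 1) ^ 2 + x ^ 2) : ℝ) : ℂ) =
    ((Real.pi * (Real.cosh (Real.pi * x) / Real.sinh (Real.pi * x)) - 1 / x : ℝ) : ℂ) := by
    have := congrArg (fun w => Complex.I * w) h1
    rw [← mul_assoc, mul_neg, Complex.I_mul_I, neg_neg, one_mul] at this
    rw [← this]
    push_cast
    field_simp
  exact_mod_cast h4

/-- Partial fractions for `tanh`. -/
theorem tanh_hasSum {x : ℝ} (hx : 0 < x) :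
    HasSum (fun k : ℕ => x / ((2 * (k:ℝ) + 1) ^ 2 + x ^ 2))
      (Real.pi / 4 * Real.tanh (x * Real.pi / 2)) := by
  have h1 := coth_hasSum hx
  have h2 := coth_hasSum (half_pos hx)
  have hodd : Summable (fun k : ℕ => 2 * x / (((2 * k : ℕ) + 1 : ℝ) ^ 2 + x ^ 2)) :=
    h1.summable.comp_injective (i := fun k : ℕ => 2 * k) (fun a b h => by simpa using h)
  have heven : HasSum (fun k : ℕ => 2 * x / (((2 * k + 1 : ℕ) + 1 : ℝ) ^ 2 + x ^ 2))
      ((1/2) * (Real.pi * (Real.cosh (Real.pi * (x/2)) / Real.sinh (Real.pi * (x/2)))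
        - 1 / (x/2))) := by
    refine (h2.mul_left (1/2)).congr_fun ?_
    intro k
    push_cast
    have : ((k:ℝ) + 1) ^ 2 + (x/2)^2 ≠ 0 := by positivity
    have : (2 * (k:ℝ) + 1 + 1) ^ 2 + x^2 ≠ 0 := by positivity
    field_simp
    ring
  have h3 := (HasSum.even_add_odd (f := fun n : ℕ => 2 * x / (((n:ℝ) + 1) ^ 2 + x ^ 2))
    hodd.hasSum heven).unique h1
  have h4 := (hodd.hasSum.mul_left (1/2))
  have hv : Real.pi / 4 * Real.tanh (x * Real.pi / 2) =
    1/2 * ∑' k : ℕ, 2 * x / (((2 * k : ℕ) + 1 : ℝ) ^ 2 + x ^ 2) := by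
    rw [eq_sub_of_add_eq h3, Real.tanh_eq_sinh_div_cosh]
    have e1 : Real.pi * x = 2 * (x * Real.pi / 2) := by ring
    have e2 : Real.pi * (x / 2) = x * Real.pi / 2 := by ring
    rw [e1, e2, Real.cosh_two_mul, Real.sinh_two_mul]
    have hs : Real.sinh (x * Real.pi / 2) ≠ 0 := (Real.sinh_pos_iff.2 (by positivity)).ne'
    have hc : Real.cosh (x * Real.pi / 2) ≠ 0 := (Real.cosh_pos _).ne'
    have hp := Real.cosh_sq (x * Real.pi / 2)
    field_simp
    ring
  rw [hv]
  refine h4.congr_fun ?_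
  intro k
  push_cast
  ring

theorem summable_odd (p : ℕ) (hp : 2 ≤ p) : Summable (fun k : ℕ => 1 / (2 * (k:ℝ) + 1) ^ p) := by
  have := (Real.summable_one_div_nat_pow (p := p)).2 (by omega)
  have h := this.comp_injective (i := fun k : ℕ => 2 * k + 1) (fun a b h => by simpa using h)
  refine h.congr ?_
  intro k
  simp

/-- Partial fractions for `sech²`. -/
theorem sech_hasSum {x : ℝ} (hx : 0 < x) :
    HasSum (fun k : ℕ => ((2 * (k:ℝ) + 1) ^ 2 - x ^ 2) / ((2 * (k:ℝ) + 1) ^ 2 + x ^ 2) ^ 2)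
      (Real.pi ^ 2 / 8 * (1 / Real.cosh (x * Real.pi / 2)) ^ 2) := by
  have hb : ∀ (k : ℕ) (y : ℝ), ‖((2 * (k:ℝ) + 1) ^ 2 - y ^ 2) / ((2 * (k:ℝ) + 1) ^ 2 + y ^ 2) ^ 2‖
      ≤ 1 / (2 * (k:ℝ) + 1) ^ 2 := by
    intro k y
    have := odd_pos' k
    rw [Real.norm_eq_abs, abs_div, abs_of_pos (by positivity : 0 < ((2 * (k:ℝ) + 1) ^ 2 + y ^ 2) ^ 2),
      div_le_div_iff₀ (by positivity) (by positivity)]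
    have h1 : |(2 * (k:ℝ) + 1) ^ 2 - y ^ 2| ≤ (2 * (k:ℝ) + 1) ^ 2 + y ^ 2 := by
      rw [abs_le]; constructor <;> nlinarith [sq_nonneg y, sq_nonneg (2 * (k:ℝ) + 1)]
    calc _ ≤ ((2 * (k:ℝ) + 1) ^ 2 + y ^ 2) * ((2 * (k:ℝ) + 1) ^ 2 + y ^ 2) := by
          gcongr
          nlinarith [sq_nonneg y]
      _ = _ := by ring
  have hd := hasDerivAt_tsum (𝕜 := ℝ) (summable_odd 2 le_rfl)
    (g := fun (k:ℕ) y => y / ((2 * (k:ℝ) + 1) ^ 2 + y ^ 2))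
    (g' := fun (k:ℕ) y => ((2 * (k:ℝ) + 1) ^ 2 - y ^ 2) / ((2 * (k:ℝ) + 1) ^ 2 + y ^ 2) ^ 2)
    (y₀ := 1) ?_ hb (tanh_hasSum one_pos).summable x
  · have hd2 : HasDerivAt (fun y : ℝ => Real.pi / 4 * Real.tanh (y * Real.pi / 2))
        (Real.pi ^ 2 / 8 * (1 / Real.cosh (x * Real.pi / 2)) ^ 2) x := by
      have hl : HasDerivAt (fun y : ℝ => y * Real.pi / 2) (Real.pi / 2) x := by
        simpa using ((hasDerivAt_id x).mul_const Real.pi).div_const 2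
      have hc : Real.cosh (x * Real.pi / 2) ≠ 0 := (Real.cosh_pos _).ne'
      have := ((hl.sinh).fun_div (hl.cosh) hc).const_mul (Real.pi / 4)
      simp only [Real.tanh_eq_sinh_div_cosh]
      convert! this using 1
      field_simp
      rw [Real.cosh_sq]
      ring
    have he : (fun y : ℝ => ∑' k : ℕ, y / ((2 * (k:ℝ) + 1) ^ 2 + y ^ 2)) =ᶠ[nhds x]
        (fun y : ℝ => Real.pi / 4 * Real.tanh (y * Real.pi / 2)) := by
      filter_upwards [lt_mem_nhds hx] with y hy
      exact (tanh_hasSum hy).tsum_eq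
    have hu := hd.unique (hd2.congr_of_eventuallyEq he)
    rw [← hu]
    exact (Summable.of_norm_bounded (summable_odd 2 le_rfl) (fun k => hb k x)).hasSum
  · intro k y
    have : (2 * (k:ℝ) + 1) ^ 2 + y ^ 2 ≠ 0 := by
      have := odd_pos' k
      positivity
    have h := (hasDerivAt_id y).fun_div (((hasDerivAt_id y).fun_pow 2).const_add ((2 * (k:ℝ) + 1) ^ 2)) this
    convert! h using 1
    simp
    ring

/-! ### Sums over odd integers of even negative powers -/

theorem odd_zeta {p : ℕ} (hp : 2 ≤ p) {s : ℝ} (h : HasSum (fun n : ℕ => 1 / (n:ℝ) ^ p) s) :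
    HasSum (fun k : ℕ => 1 / (2 * (k:ℝ) + 1) ^ p) ((1 - 1 / 2 ^ p) * s) := by
  have ho := (summable_odd p hp).hasSum
  have he : HasSum (fun k : ℕ => 1 / ((2 * k : ℕ) : ℝ) ^ p) (1 / 2 ^ p * s) := by
    refine (h.mul_left (1 / 2 ^ p)).congr_fun ?_
    intro k
    push_cast
    rw [mul_pow, one_div_mul_one_div]
  have ho' : HasSum (fun k : ℕ => 1 / ((2 * k + 1 : ℕ) : ℝ) ^ p)
      (∑' k : ℕ, 1 / (2 * (k:ℝ) + 1) ^ p) := by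
    refine ho.congr_fun ?_
    intro k
    push_cast
    rfl
  have := (HasSum.even_add_odd (f := fun n : ℕ => 1 / (n:ℝ) ^ p) he ho').unique h
  have e : (1 - 1 / 2 ^ p) * s = ∑' k : ℕ, 1 / (2 * (k:ℝ) + 1) ^ p := by linarith
  rw [e]
  exact ho

theorem bern5 : bernoulli' 5 = 0 := by
  rw [bernoulli'_def]
  have h : Nat.choose 5 2 = 10 ∧ Nat.choose 5 3 = 10 ∧ Nat.choose 5 4 = 5 := by decide
  norm_num [Finset.sum_range_succ, h]

theorem bern6 : bernoulli' 6 = 1 / 42 := by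
  rw [bernoulli'_def]
  have h : Nat.choose 6 2 = 15 ∧ Nat.choose 6 3 = 20 ∧ Nat.choose 6 4 = 15 ∧ Nat.choose 6 5 = 6 := by
    decide
  norm_num [Finset.sum_range_succ, h, bern5]

theorem bern7 : bernoulli' 7 = 0 := by
  rw [bernoulli'_def]
  have h : Nat.choose 7 2 = 21 ∧ Nat.choose 7 3 = 35 ∧ Nat.choose 7 4 = 35 ∧ Nat.choose 7 5 = 21
    ∧ Nat.choose 7 6 = 7 := by decide
  norm_num [Finset.sum_range_succ, h, bern5, bern6]

theorem bern8 : bernoulli' 8 = -1 / 30 := by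
  rw [bernoulli'_def]
  have h : Nat.choose 8 2 = 28 ∧ Nat.choose 8 3 = 56 ∧ Nat.choose 8 4 = 70 ∧ Nat.choose 8 5 = 56
    ∧ Nat.choose 8 6 = 28 ∧ Nat.choose 8 7 = 8 := by decide
  norm_num [Finset.sum_range_succ, h, bern5, bern6, bern7]

theorem lam2 : HasSum (fun k : ℕ => 1 / (2 * (k:ℝ) + 1) ^ 2) (Real.pi ^ 2 / 8) := by
  convert! odd_zeta le_rfl hasSum_zeta_two using 1
  ring

theorem lam4 : HasSum (fun k : ℕ => 1 / (2 * (k:ℝ) + 1) ^ 4) (Real.pi ^ 4 / 96) := by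
  convert! odd_zeta (by norm_num) hasSum_zeta_four using 1
  ring

theorem lam6 : HasSum (fun k : ℕ => 1 / (2 * (k:ℝ) + 1) ^ 6) (Real.pi ^ 6 / 960) := by
  convert! odd_zeta (by norm_num) (hasSum_zeta_nat (k := 3) (by norm_num)) using 1
  rw [bernoulli_eq_bernoulli'_of_ne_one (by norm_num), bern6]
  norm_num [Nat.factorial]
  ring

theorem lam8 : HasSum (fun k : ℕ => 1 / (2 * (k:ℝ) + 1) ^ 8) (17 * Real.pi ^ 8 / 161280) := by
  convert! odd_zeta (by norm_num) (hasSum_zeta_nat (k := 4) (by norm_num)) using 1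
  rw [bernoulli_eq_bernoulli'_of_ne_one (by norm_num), bern8]
  norm_num [Nat.factorial]
  ring

theorem lam_mul {p q : ℕ} {s t : ℝ} (hp : HasSum (fun k : ℕ => 1 / (2 * (k:ℝ) + 1) ^ p) s)
    (hq : HasSum (fun k : ℕ => 1 / (2 * (k:ℝ) + 1) ^ q) t) :
    HasSum (fun x : ℕ × ℕ => 1 / (2 * (x.1:ℝ) + 1) ^ p * (1 / (2 * (x.2:ℝ) + 1) ^ q)) (s * t) :=
  hp.mul hq (hp.summable.mul_of_nonneg hq.summable
    (fun k => by have := odd_pos' k; positivity) (fun k => by have := odd_pos' k; positivity))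

/-! ### Symmetrization of double sums -/

theorem symm_sum {F : ℕ × ℕ → ℝ} {G : ℕ × ℕ → ℝ} {r : ℕ → ℝ} {S C : ℝ}
    (hF : ∀ x, |F x| ≤ C * (1 / (2 * (x.1:ℝ) + 1) ^ 2 * (1 / (2 * (x.2:ℝ) + 1) ^ 2)))
    (hr : ∀ n, HasSum (fun k => F (n, k)) (r n))
    (hG : HasSum G S) (hFG : ∀ x, F x + F x.swap = G x) : HasSum r (S / 2) := by
  have hs : Summable F := Summable.of_norm_bounded ((lam_mul lam2 lam2).summable.mul_left C) hF
  have h1 := hs.hasSum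
  have h2 : HasSum (fun x : ℕ × ℕ => F x.swap) (∑' x, F x) :=
    (Equiv.prodComm ℕ ℕ).hasSum_iff.2 h1
  have h3 := h1.add h2
  simp only [hFG] at h3
  have h4 := h3.unique hG
  have h5 : S / 2 = ∑' x, F x := by linarith
  rw [h5]
  exact h1.prod_fiberwise hr

theorem tanh_odd (n : ℕ) : HasSum (fun k : ℕ => 1 / ((2 * (k:ℝ) + 1) ^ 2 + (2 * (n:ℝ) + 1) ^ 2))
    (Real.pi / 4 * Real.tanh ((2 * (n:ℝ) + 1) * Real.pi / 2) / (2 * (n:ℝ) + 1)) := by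
  have h0 := odd_pos' n
  refine ((tanh_hasSum h0).div_const (2 * (n:ℝ) + 1)).congr_fun ?_
  intro k
  have h1 := odd_pos' k
  field_simp

/-- Basic term bound. -/
theorem bound_aux {M N c d : ℝ} (hM : 1 ≤ M) (hN : 1 ≤ N) (j : ℕ) (hc : 0 ≤ c) (hcd : c ≤ d) :
    |(c * M + d * N) / (N ^ (j + 1) * (M + N) ^ 2)| ≤ d * (1 / N * (1 / M)) := by
  have hd : 0 ≤ d := hc.trans hcd
  have hM0 : 0 < M := by linarith
  have hN0 : 0 < N := by linarith
  rw [abs_of_nonneg (by positivity)]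
  have : (c * M + d * N) / (N ^ (j + 1) * (M + N) ^ 2) ≤ d * (M + N) / (N * (M + N) ^ 2) := by
    gcongr
    · nlinarith
    · exact le_self_pow₀ hN (by omega)
  refine this.trans ?_
  have e : d * (M + N) / (N * (M + N) ^ 2) = d * (1 / N * (1 / (M + N))) := by
    field_simp
  rw [e]
  gcongr
  linarith

theorem S7 : HasSum (fun n : ℕ => Real.tanh ((2 * (n:ℝ) + 1) * Real.pi / 2) / (2 * (n:ℝ) + 1) ^ 7)
    (7 * Real.pi ^ 7 / 23040) := by
  have hG := ((lam_mul lam2 lam6).add (lam_mul lam6 lam2)).sub (lam_mul lam4 lam4)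
  have h := symm_sum (C := 1)
    (F := fun x => 1 / (2 * (x.1:ℝ) + 1) ^ 6 *
      (1 / ((2 * (x.2:ℝ) + 1) ^ 2 + (2 * (x.1:ℝ) + 1) ^ 2)))
    ?_ (fun n => (tanh_odd n).mul_left (1 / (2 * (n:ℝ) + 1) ^ 6)) hG ?_
  · convert! h.mul_left (4 / Real.pi) using 1
    · ext n
      have := odd_pos' n
      have := Real.pi_pos
      field_simp
    · have := Real.pi_pos
      field_simp
      ring
  · rintro ⟨n, k⟩
    have h1 := odd_ge n
    have h2 := odd_ge k
    rw [abs_of_nonneg (by positivity), one_mul]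
    gcongr
    · norm_num
    · nlinarith
  · rintro ⟨n, k⟩
    have h1 := odd_pos' n
    have h2 := odd_pos' k
    simp only [Prod.swap]
    generalize 2 * (n:ℝ) + 1 = x at *
    generalize 2 * (k:ℝ) + 1 = y at *
    have : x ^ 2 + y ^ 2 ≠ 0 := by positivity
    have : y ^ 2 + x ^ 2 ≠ 0 := by positivity
    field_simp
    ring

theorem S5 : HasSum (fun n : ℕ =>
      4 * (Real.tanh ((2 * (n:ℝ) + 1) * Real.pi / 2) / (2 * (n:ℝ) + 1) ^ 5) -
      Real.pi * ((1 / Real.cosh ((2 * (n:ℝ) + 1) * Real.pi / 2)) ^ 2 / (2 * (n:ℝ) + 1) ^ 4))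
    (Real.pi ^ 5 / 96) := by
  have hG := (lam_mul lam2 lam4).add (lam_mul lam4 lam2)
  have h := symm_sum (C := 3)
    (F := fun x => (1 * (2 * (x.2:ℝ) + 1) ^ 2 + 3 * (2 * (x.1:ℝ) + 1) ^ 2) /
      (((2 * (x.1:ℝ) + 1) ^ 2) ^ (1 + 1) *
        ((2 * (x.2:ℝ) + 1) ^ 2 + (2 * (x.1:ℝ) + 1) ^ 2) ^ 2))
    (r := fun n => 2 / (2 * (n:ℝ) + 1) ^ 4 *
      (Real.pi / 4 * Real.tanh ((2 * (n:ℝ) + 1) * Real.pi / 2) / (2 * (n:ℝ) + 1)) -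
      1 / (2 * (n:ℝ) + 1) ^ 4 *
        (Real.pi ^ 2 / 8 * (1 / Real.cosh ((2 * (n:ℝ) + 1) * Real.pi / 2)) ^ 2))
    ?_ ?_ hG ?_
  · convert! h.mul_left (8 / Real.pi) using 1
    · ext n
      have := odd_pos' n
      have := Real.pi_pos
      have := Real.cosh_pos ((2 * (n:ℝ) + 1) * Real.pi / 2)
      generalize Real.cosh ((2 * (n:ℝ) + 1) * Real.pi / 2) = c at *
      field_simp
      ring
    · have := Real.pi_pos
      field_simp
      ring
  · rintro ⟨n, k⟩
    have h1 := odd_ge n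
    have h2 := odd_ge k
    exact bound_aux (one_le_pow₀ h2) (one_le_pow₀ h1) 1 (by norm_num) (by norm_num)
  · intro n
    refine (((tanh_odd n).mul_left (2 / (2 * (n:ℝ) + 1) ^ 4)).sub
      ((sech_hasSum (odd_pos' n)).mul_left (1 / (2 * (n:ℝ) + 1) ^ 4))).congr_fun ?_
    intro k
    have h1 := odd_pos' n
    have h2 := odd_pos' k
    field_simp
    ring
  · rintro ⟨n, k⟩
    have h1 := odd_pos' n
    have h2 := odd_pos' k
    simp only [Prod.swap]
    generalize 2 * (n:ℝ) + 1 = x at *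
    generalize 2 * (k:ℝ) + 1 = y at *
    rw [add_comm (x ^ 2) (y ^ 2)]
    have : y ^ 2 + x ^ 2 ≠ 0 := by positivity
    field_simp
    ring

theorem S9 : HasSum (fun n : ℕ =>
      4 * (Real.tanh ((2 * (n:ℝ) + 1) * Real.pi / 2) / (2 * (n:ℝ) + 1) ^ 9) -
      Real.pi / 2 * ((1 / Real.cosh ((2 * (n:ℝ) + 1) * Real.pi / 2)) ^ 2 / (2 * (n:ℝ) + 1) ^ 8))
    (4 / Real.pi * ((6 * (Real.pi ^ 2 / 8 * (17 * Real.pi ^ 8 / 161280)) -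
      2 * (Real.pi ^ 4 / 96 * (Real.pi ^ 6 / 960))) / 2)) := by
  have hG := (((lam_mul lam2 lam8).add (lam_mul lam8 lam2)).mul_left 3).sub
    ((lam_mul lam4 lam6).add (lam_mul lam6 lam4))
  have h := symm_sum (C := 5)
    (F := fun x => (3 * (2 * (x.2:ℝ) + 1) ^ 2 + 5 * (2 * (x.1:ℝ) + 1) ^ 2) /
      (((2 * (x.1:ℝ) + 1) ^ 2) ^ (3 + 1) *
        ((2 * (x.2:ℝ) + 1) ^ 2 + (2 * (x.1:ℝ) + 1) ^ 2) ^ 2))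
    (r := fun n => 4 / (2 * (n:ℝ) + 1) ^ 8 *
      (Real.pi / 4 * Real.tanh ((2 * (n:ℝ) + 1) * Real.pi / 2) / (2 * (n:ℝ) + 1)) -
      1 / (2 * (n:ℝ) + 1) ^ 8 *
        (Real.pi ^ 2 / 8 * (1 / Real.cosh ((2 * (n:ℝ) + 1) * Real.pi / 2)) ^ 2))
    ?_ ?_ hG ?_
  · convert! h.mul_left (4 / Real.pi) using 1
    · ext n
      have := odd_pos' n
      have := Real.pi_pos
      have := Real.cosh_pos ((2 * (n:ℝ) + 1) * Real.pi / 2)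
      generalize Real.cosh ((2 * (n:ℝ) + 1) * Real.pi / 2) = c at *
      field_simp
      ring
    · have := Real.pi_pos
      field_simp
      ring
  · rintro ⟨n, k⟩
    have h1 := odd_ge n
    have h2 := odd_ge k
    exact bound_aux (one_le_pow₀ h2) (one_le_pow₀ h1) 3 (by norm_num) (by norm_num)
  · intro n
    refine (((tanh_odd n).mul_left (4 / (2 * (n:ℝ) + 1) ^ 8)).sub
      ((sech_hasSum (odd_pos' n)).mul_left (1 / (2 * (n:ℝ) + 1) ^ 8))).congr_fun ?_
    intro k
    have h1 := odd_pos' n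
    have h2 := odd_pos' k
    field_simp
    ring
  · rintro ⟨n, k⟩
    have h1 := odd_pos' n
    have h2 := odd_pos' k
    simp only [Prod.swap]
    generalize 2 * (n:ℝ) + 1 = x at *
    generalize 2 * (k:ℝ) + 1 = y at *
    rw [add_comm (x ^ 2) (y ^ 2)]
    have : y ^ 2 + x ^ 2 ≠ 0 := by positivity
    field_simp
    ring

/-! ### Moments -/

theorem cos_odd_pi (n : ℕ) : Real.cos ((2 * (n:ℝ) + 1) * Real.pi) = -1 := by
  have : (2 * (n:ℝ) + 1) * Real.pi = Real.pi + n * (2 * Real.pi) := by ring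
  rw [this, Real.cos_add_nat_mul_two_pi, Real.cos_pi]

theorem sin_odd_pi (n : ℕ) : Real.sin ((2 * (n:ℝ) + 1) * Real.pi) = 0 := by
  have : (2 * (n:ℝ) + 1) * Real.pi = Real.pi + n * (2 * Real.pi) := by ring
  rw [this, Real.sin_add_nat_mul_two_pi, Real.sin_pi]

theorem int_aux (c : ℝ) (k : ℕ) (P Q : ℝ → ℝ) (P' Q' : ℝ → ℝ)
    (hP : ∀ z, HasDerivAt P (P' z) z) (hQ : ∀ z, HasDerivAt Q (Q' z) z)
    (h1 : ∀ z, P' z + c * Q z = 0) (h2 : ∀ z, Q' z - c * P z = z ^ k) :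
    ∫ z in (0:ℝ)..1, z ^ k * Real.sin (c * z) =
      P 1 * Real.cos c + Q 1 * Real.sin c - P 0 := by
  have hd : ∀ z ∈ Set.uIcc (0:ℝ) 1, HasDerivAt
      (fun z => P z * Real.cos (c * z) + Q z * Real.sin (c * z))
      (z ^ k * Real.sin (c * z)) z := by
    intro z _
    have hl : HasDerivAt (fun z : ℝ => c * z) c z := by
      simpa using (hasDerivAt_id z).const_mul c
    convert! ((hP z).fun_mul hl.cos).fun_add ((hQ z).fun_mul hl.sin) using 1
    linear_combination (-Real.cos (c * z)) * h1 z - Real.sin (c * z) * h2 z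
  rw [intervalIntegral.integral_eq_sub_of_hasDerivAt hd
    (Continuous.intervalIntegrable (by fun_prop) _ _)]
  simp

theorem int1 {c : ℝ} (hc : c ≠ 0) (h1 : Real.cos c = -1) (h2 : Real.sin c = 0) :
    ∫ z in (0:ℝ)..1, z ^ 1 * Real.sin (c * z) = 1 / c - 0 / c ^ 3 + 0 / c ^ 5 := by
  rw [int_aux c 1 (fun z => -z / c) (fun _ => 1 / c ^ 2) (fun _ => -1 / c) (fun _ => 0)
    (fun z => ((hasDerivAt_id z).neg.div_const c)) (fun z => hasDerivAt_const _ _)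
    (fun z => by field_simp; ring) (fun z => by field_simp; ring), h1, h2]
  field_simp
  ring

theorem int2 {c : ℝ} (hc : c ≠ 0) (h1 : Real.cos c = -1) (h2 : Real.sin c = 0) :
    ∫ z in (0:ℝ)..1, z ^ 2 * Real.sin (c * z) = 1 / c - 4 / c ^ 3 + 0 / c ^ 5 := by
  rw [int_aux c 2 (fun z => -z ^ 2 / c + 2 / c ^ 3) (fun z => 2 * z / c ^ 2)
    (fun z => -(2 * z) / c) (fun _ => 2 / c ^ 2)
    (fun z => by simpa using ((hasDerivAt_pow 2 z).fun_neg.div_const c).add_const (2 / c ^ 3))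
    (fun z => by simpa using ((hasDerivAt_id z).const_mul 2).div_const (c ^ 2))
    (fun z => by field_simp; ring) (fun z => by field_simp; ring), h1, h2]
  field_simp
  ring

theorem int3 {c : ℝ} (hc : c ≠ 0) (h1 : Real.cos c = -1) (h2 : Real.sin c = 0) :
    ∫ z in (0:ℝ)..1, z ^ 3 * Real.sin (c * z) = 1 / c - 6 / c ^ 3 + 0 / c ^ 5 := by
  rw [int_aux c 3 (fun z => -z ^ 3 / c + 6 / c ^ 3 * z) (fun z => 3 / c ^ 2 * z ^ 2 - 6 / c ^ 4)
    (fun z => -(3 * z ^ 2) / c + 6 / c ^ 3) (fun z => 3 / c ^ 2 * (2 * z))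
    (fun z => by simpa using ((hasDerivAt_pow 3 z).fun_neg.div_const c).fun_add ((hasDerivAt_id z).const_mul (6 / c ^ 3)))
    (fun z => by simpa using ((hasDerivAt_pow 2 z).const_mul (3 / c ^ 2)).sub_const (6 / c ^ 4))
    (fun z => by field_simp; ring) (fun z => by field_simp; ring), h1, h2]
  field_simp
  ring

theorem int4 {c : ℝ} (hc : c ≠ 0) (h1 : Real.cos c = -1) (h2 : Real.sin c = 0) :
    ∫ z in (0:ℝ)..1, z ^ 4 * Real.sin (c * z) = 1 / c - 12 / c ^ 3 + 48 / c ^ 5 := by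
  rw [int_aux c 4 (fun z => -z ^ 4 / c + 12 / c ^ 3 * z ^ 2 - 24 / c ^ 5)
    (fun z => 4 / c ^ 2 * z ^ 3 - 24 / c ^ 4 * z)
    (fun z => -(4 * z ^ 3) / c + 12 / c ^ 3 * (2 * z)) (fun z => 4 / c ^ 2 * (3 * z ^ 2) - 24 / c ^ 4)
    (fun z => by simpa using (((hasDerivAt_pow 4 z).fun_neg.div_const c).fun_add ((hasDerivAt_pow 2 z).const_mul (12 / c ^ 3))).sub_const (24 / c ^ 5))
    (fun z => by simpa using ((hasDerivAt_pow 3 z).const_mul (4 / c ^ 2)).fun_sub ((hasDerivAt_id z).const_mul (24 / c ^ 4)))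
    (fun z => by field_simp; ring) (fun z => by field_simp; ring), h1, h2]
  field_simp
  ring

theorem a_odd (n : ℕ) : a (2 * n + 1) =
    4 / (2 * (n:ℝ) + 1) ^ 4 * Real.tanh ((2 * (n:ℝ) + 1) * Real.pi / 2)
      - Real.pi / (2 * (n:ℝ) + 1) ^ 3 := by
  simp [a]

theorem a_bound (n : ℕ) : |a (2 * n + 1)| ≤ (4 + Real.pi) * (1 / (2 * (n:ℝ) + 1) ^ 3) := by
  rw [a_odd]
  have h1 := odd_ge n
  have hpi := Real.pi_pos
  have ht := (Real.abs_tanh_lt_one ((2 * (n:ℝ) + 1) * Real.pi / 2)).le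
  refine (abs_sub _ _).trans ?_
  rw [abs_mul, abs_of_pos (by positivity : 0 < 4 / (2 * (n:ℝ) + 1) ^ 4),
    abs_of_pos (by positivity : 0 < Real.pi / (2 * (n:ℝ) + 1) ^ 3), add_mul (4:ℝ)]
  have : 4 / (2 * (n:ℝ) + 1) ^ 4 * |Real.tanh ((2 * (n:ℝ) + 1) * Real.pi / 2)|
      ≤ 4 / (2 * (n:ℝ) + 1) ^ 3 * 1 := by
    gcongr
    · norm_num
  rw [mul_one_div, mul_one_div]
  linarith

theorem A1 {E : ℝ} (hE : HasSum (fun k : ℕ => (1 / Real.cosh ((2 * (k : ℝ) + 1) * Real.pi / 2)) ^ 2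
    / (2 * (k : ℝ) + 1) ^ 4) E) :
    HasSum (fun n : ℕ => a (2 * n + 1) / (2 * (n:ℝ) + 1)) (Real.pi * E) := by
  convert! (S5.add (hE.mul_left Real.pi)).sub (lam4.mul_left Real.pi) using 1
  · ext n
    have := odd_pos' n
    rw [a_odd]
    field_simp
    ring
  · ring

theorem A3 : HasSum (fun n : ℕ => a (2 * n + 1) / (2 * (n:ℝ) + 1) ^ 3) (Real.pi ^ 7 / 5760) := by
  convert! (S7.mul_left 4).sub (lam6.mul_left Real.pi) using 1
  · ext n
    have := odd_pos' n
    rw [a_odd]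
    field_simp
  · ring

theorem A5 {E : ℝ} (hE : HasSum (fun k : ℕ => (1 / Real.cosh ((2 * (k : ℝ) + 1) * Real.pi / 2)) ^ 2
    / (2 * (k : ℝ) + 1) ^ 8) E) :
    HasSum (fun n : ℕ => a (2 * n + 1) / (2 * (n:ℝ) + 1) ^ 5)
      (Real.pi / 2 * E + Real.pi ^ 9 / 107520) := by
  convert! (S9.add (hE.mul_left (Real.pi / 2))).sub (lam8.mul_left Real.pi) using 1
  · ext n
    have := odd_pos' n
    rw [a_odd]
    field_simp
    ring
  · have := Real.pi_pos
    field_simp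
    ring

theorem sech_summable (p : ℕ) (hp : 2 ≤ p) :
    Summable (fun k : ℕ => (1 / Real.cosh ((2 * (k : ℝ) + 1) * Real.pi / 2)) ^ 2
    / (2 * (k : ℝ) + 1) ^ p) := by
  refine (summable_odd p hp).of_nonneg_of_le (fun k => ?_) (fun k => ?_)
  · have := odd_pos' k
    positivity
  · have := odd_pos' k
    gcongr
    apply pow_le_one₀
    · have := Real.cosh_pos ((2 * (k : ℝ) + 1) * Real.pi / 2)
      positivity
    · rw [div_le_one (Real.cosh_pos _)]
      exact Real.one_le_cosh _

theorem moment_gen (k : ℕ) (q r : ℝ)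
    (hI : ∀ c : ℝ, c ≠ 0 → Real.cos c = -1 → Real.sin c = 0 →
      ∫ z in (0:ℝ)..1, z ^ k * Real.sin (c * z) = 1 / c - q / c ^ 3 + r / c ^ 5)
    {s1 s3 s5 : ℝ}
    (h1 : HasSum (fun n : ℕ => a (2 * n + 1) / (2 * (n:ℝ) + 1)) s1)
    (h3 : HasSum (fun n : ℕ => a (2 * n + 1) / (2 * (n:ℝ) + 1) ^ 3) s3)
    (h5 : HasSum (fun n : ℕ => a (2 * n + 1) / (2 * (n:ℝ) + 1) ^ 5) s5) :
    m k = 24 / Real.pi ^ 4 * (s1 / Real.pi - q * s3 / Real.pi ^ 3 + r * s5 / Real.pi ^ 5) / mu := by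
  have hpi := Real.pi_pos
  have hsb : Summable (fun n : ℕ => (4 + Real.pi) * (1 / (2 * (n:ℝ) + 1) ^ 3)) :=
    (summable_odd 3 (by norm_num)).mul_left _
  have hb : ∀ (n : ℕ) (z : ℝ), |a (2 * n + 1) * Real.sin ((2 * (n:ℝ) + 1) * Real.pi * z)| ≤
      (4 + Real.pi) * (1 / (2 * (n:ℝ) + 1) ^ 3) := by
    intro n z
    rw [abs_mul]
    calc _ ≤ |a (2 * n + 1)| * 1 := by
          gcongr
          exact Real.abs_sin_le_one _
      _ ≤ _ := by rw [mul_one]; exact a_bound n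
  have hsum : HasSum (fun n : ℕ => ∫ z in (0:ℝ)..1,
      z ^ k * (a (2 * n + 1) * Real.sin ((2 * (n:ℝ) + 1) * Real.pi * z)))
      (∫ z in (0:ℝ)..1, z ^ k *
        ∑' n : ℕ, a (2 * n + 1) * Real.sin ((2 * (n:ℝ) + 1) * Real.pi * z)) := by
    refine intervalIntegral.hasSum_integral_of_dominated_convergence
      (fun n _ => (4 + Real.pi) * (1 / (2 * (n:ℝ) + 1) ^ 3)) ?_ ?_ ?_ ?_ ?_
    · intro n
      exact Continuous.aestronglyMeasurable (by fun_prop)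
    · intro n
      refine Filter.Eventually.of_forall (fun z hz => ?_)
      rw [Set.uIoc_of_le zero_le_one] at hz
      rw [Real.norm_eq_abs, abs_mul]
      calc _ ≤ 1 * ((4 + Real.pi) * (1 / (2 * (n:ℝ) + 1) ^ 3)) := by
            gcongr
            · rw [abs_of_nonneg (pow_nonneg hz.1.le k)]
              exact pow_le_one₀ hz.1.le hz.2
            · exact hb n z
        _ = _ := one_mul _
    · exact Filter.Eventually.of_forall (fun z _ => hsb)
    · exact intervalIntegrable_const
    · refine Filter.Eventually.of_forall (fun z _ => ?_)
      have hsz : Summable (fun n : ℕ =>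
          a (2 * n + 1) * Real.sin ((2 * (n:ℝ) + 1) * Real.pi * z)) := by
        refine Summable.of_norm_bounded hsb (fun n => ?_)
        rw [Real.norm_eq_abs]
        exact hb n z
      exact hsz.hasSum.mul_left (z ^ k)
  have hterm : HasSum (fun n : ℕ => ∫ z in (0:ℝ)..1,
      z ^ k * (a (2 * n + 1) * Real.sin ((2 * (n:ℝ) + 1) * Real.pi * z)))
      (s1 / Real.pi - q * s3 / Real.pi ^ 3 + r * s5 / Real.pi ^ 5) := by
    refine (((h1.div_const Real.pi).sub ((h3.mul_left q).div_const (Real.pi ^ 3))).add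
      ((h5.mul_left r).div_const (Real.pi ^ 5))).congr_fun ?_
    intro n
    have h0 := odd_pos' n
    have e : ∀ z : ℝ, z ^ k * (a (2 * n + 1) * Real.sin ((2 * (n:ℝ) + 1) * Real.pi * z)) =
      a (2 * n + 1) * (z ^ k * Real.sin ((2 * (n:ℝ) + 1) * Real.pi * z)) := fun z => by ring
    simp_rw [e]
    rw [intervalIntegral.integral_const_mul,
      hI _ (by positivity) (cos_odd_pi n) (sin_odd_pi n)]
    field_simp
  rw [← hsum.unique hterm]
  unfold m phi0 psi
  rw [← intervalIntegral.integral_const_mul, ← intervalIntegral.integral_div]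
  congr 1
  ext z
  ring

theorem mu_pos : 0 < mu := by
  unfold mu
  have hpi := Real.pi_pos
  refine mul_pos (by positivity) ?_
  refine (sech_summable 4 (by norm_num)).tsum_pos (fun k => ?_) 0 ?_
  · positivity
  · have := Real.cosh_pos ((2 * ((0:ℕ) : ℝ) + 1) * Real.pi / 2)
    have := odd_pos' 0
    positivity

/-- The moments of `φ_0`: `m_1 = 1/2`, `m_2 = 1/2 − 1/(60μ)`, `m_3 = 1/2 − 1/(40μ)`, and
`m_4 = 1/2 − 11/(280μ) + (576/(μπ^8)) Σ_{n odd} sech²(nπ/2)/n^8`. -/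
theorem moments_phi0 :
    m 1 = 1 / 2 ∧
    m 2 = 1 / 2 - 1 / (60 * mu) ∧
    m 3 = 1 / 2 - 1 / (40 * mu) ∧
    m 4 = 1 / 2 - 11 / (280 * mu) +
      (576 / (mu * Real.pi ^ 8)) *
        ∑' k : ℕ, (1 / Real.cosh ((2 * (k : ℝ) + 1) * Real.pi / 2)) ^ 2
          / (2 * (k : ℝ) + 1) ^ 8 := by
  have hpi := Real.pi_pos
  have hmu := mu_pos
  have hE4 := (sech_summable 4 (by norm_num)).hasSum
  have hE8 := (sech_summable 8 (by norm_num)).hasSum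
  have h1 := A1 hE4
  have h5 := A5 hE8
  have hE : ∑' k : ℕ, (1 / Real.cosh ((2 * (k : ℝ) + 1) * Real.pi / 2)) ^ 2
      / (2 * (k : ℝ) + 1) ^ 4 = mu * Real.pi ^ 4 / 48 := by
    unfold mu
    generalize (∑' k : ℕ, (1 / Real.cosh ((2 * (k : ℝ) + 1) * Real.pi / 2)) ^ 2
      / (2 * (k : ℝ) + 1) ^ 4) = E
    field_simp
  rw [hE] at h1
  refine ⟨?_, ?_, ?_, ?_⟩
  · rw [moment_gen 1 0 0 (fun c h h' h'' => int1 h h' h'') h1 A3 h5]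
    field_simp
    ring
  · rw [moment_gen 2 4 0 (fun c h h' h'' => int2 h h' h'') h1 A3 h5]
    field_simp
    ring
  · rw [moment_gen 3 6 0 (fun c h h' h'' => int3 h h' h'') h1 A3 h5]
    field_simp
    ring
  · rw [moment_gen 4 12 48 (fun c h h' h'' => int4 h h' h'') h1 A3 h5]
    generalize (∑' k : ℕ, (1 / Real.cosh ((2 * (k : ℝ) + 1) * Real.pi / 2)) ^ 2
          / (2 * (k : ℝ) + 1) ^ 8) = E
    field_simp
    ring
end

section
/- For all x with 0 < x < 2π, the Clausen-type series S_4(x) := Σ_{n≥1} sin(nx)/n^4 satisfies S_4(x) = x·ζ(3) + (x^3/6)·log x − (11/36)·x^3 − (x^5/2) · Σ_{n≥0} |B(2n+2)| · x^{2n} / ((n+1)·(2n+5)!), where ζ is the Riemann zeta function and |B(2ℓ)| denotes the absolute value of the (2ℓ)-th Bernoulli number, given by |B(2ℓ)| = 2·ζ(2ℓ)·(2ℓ)!/(2π)^{2ℓ}. -/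
/-- `ζ(s) = Σ_{n≥1} n^{−s}` (for natural `s`, as a real series). -/
noncomputable def zetaR (s : ℕ) : ℝ := ∑' n : ℕ, 1 / ((n : ℝ) + 1) ^ s

/-- `|B(2ℓ)| = 2·ζ(2ℓ)·(2ℓ)!/(2π)^{2ℓ}`, the absolute value of the `(2ℓ)`-th Bernoulli
number. -/
noncomputable def Babs (l : ℕ) : ℝ :=
  2 * zetaR (2 * l) * (Nat.factorial (2 * l)) / (2 * Real.pi) ^ (2 * l)

/-- `S_4(x) = Σ_{n≥1} sin(nx)/n^4`. -/
noncomputable def S4 (x : ℝ) : ℝ := ∑' n : ℕ, Real.sin (((n : ℝ) + 1) * x) / ((n : ℝ) + 1) ^ 4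

lemma aux_sum (m : ℕ) (hm : 2 ≤ m) : Summable (fun n : ℕ => 1 / ((n : ℝ) + 1) ^ m) := by
  have h := (summable_nat_add_iff 1).2 ((Real.summable_one_div_nat_pow (p := m)).2 (by omega))
  simpa using h

noncomputable def S3c (x : ℝ) : ℝ := ∑' n : ℕ, Real.cos (((n : ℝ) + 1) * x) / ((n : ℝ) + 1) ^ 3
noncomputable def S2s (x : ℝ) : ℝ := ∑' n : ℕ, Real.sin (((n : ℝ) + 1) * x) / ((n : ℝ) + 1) ^ 2

lemma S4_deriv (x : ℝ) : HasDerivAt S4 (S3c x) x := by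
  unfold S3c
  refine hasDerivAt_tsum (g := fun (n:ℕ) (x:ℝ) => Real.sin (((n : ℝ) + 1) * x) / ((n : ℝ) + 1) ^ 4)
    (g' := fun (n:ℕ) (x:ℝ) => Real.cos (((n : ℝ) + 1) * x) / ((n : ℝ) + 1) ^ 3)
    (aux_sum 3 (by norm_num)) (y₀ := 0) ?_ ?_ ?_ x
  · intro n y
    have h1 : HasDerivAt (fun x : ℝ => ((n : ℝ) + 1) * x) ((n : ℝ) + 1) y := by
      simpa using (hasDerivAt_id y).const_mul ((n : ℝ) + 1)
    have := (h1.sin).div_const (((n : ℝ) + 1) ^ 4)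
    refine this.congr_deriv ?_
    field_simp
  · intro n y
    rw [norm_div, Real.norm_eq_abs, Real.norm_eq_abs, abs_of_pos (a := ((n : ℝ) + 1) ^ 3) (by positivity)]
    gcongr
    exact Real.abs_cos_le_one _
  · simpa using summable_zero

lemma S3c_deriv (x : ℝ) : HasDerivAt S3c (-S2s x) x := by
  unfold S2s
  rw [← tsum_neg]
  refine hasDerivAt_tsum (g := fun (n:ℕ) (x:ℝ) => Real.cos (((n : ℝ) + 1) * x) / ((n : ℝ) + 1) ^ 3)
    (g' := fun (n:ℕ) (x:ℝ) => -(Real.sin (((n : ℝ) + 1) * x) / ((n : ℝ) + 1) ^ 2))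
    (aux_sum 2 (by norm_num)) (y₀ := 0) ?_ ?_ ?_ x
  · intro n y
    have h1 : HasDerivAt (fun x : ℝ => ((n : ℝ) + 1) * x) ((n : ℝ) + 1) y := by
      simpa using (hasDerivAt_id y).const_mul ((n : ℝ) + 1)
    have := (h1.cos).div_const (((n : ℝ) + 1) ^ 3)
    refine this.congr_deriv ?_
    field_simp
  · intro n y
    rw [norm_neg, norm_div, Real.norm_eq_abs, Real.norm_eq_abs, abs_of_pos (a := ((n : ℝ) + 1) ^ 2) (by positivity)]
    gcongr
    exact Real.abs_sin_le_one _
  · simpa using aux_sum 3 (by norm_num)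

lemma S2s_cont : Continuous S2s := by
  unfold S2s
  refine continuous_tsum (fun n => by fun_prop) (aux_sum 2 (by norm_num)) ?_
  intro n y
  rw [norm_div, Real.norm_eq_abs, Real.norm_eq_abs, abs_of_pos (a := ((n : ℝ) + 1) ^ 2) (by positivity)]
  gcongr
  exact Real.abs_sin_le_one _

lemma pos_aux (r x : ℝ) (hr : 0 < r) (h0 : 0 < x) (h1 : x < 2 * Real.pi) :
    0 < 1 - 2 * r * Real.cos x + r ^ 2 := by
  have h2 : Real.cos x < 1 := by
    have : 0 < Real.sin (x/2) := Real.sin_pos_of_pos_of_lt_pi (by linarith) (by linarith)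
    have h3 : Real.cos x = 1 - 2 * Real.sin (x/2)^2 := by
      have := Real.cos_two_mul (x/2)
      have h4 := Real.sin_sq_add_cos_sq (x/2)
      rw [show 2 * (x/2) = x by ring] at this
      linarith
    nlinarith
  nlinarith [sq_nonneg (1 - r), mul_pos hr (sub_pos.2 h2)]

lemma cos_series (r x : ℝ) (hr : 0 < r) (hr1 : r < 1) :
    HasSum (fun n : ℕ => r ^ (n+1) * Real.cos (((n : ℝ) + 1) * x) / ((n : ℝ) + 1))
      (-(1/2) * Real.log (1 - 2 * r * Real.cos x + r ^ 2)) := by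
  have hz : ‖(r : ℂ) * Complex.exp (x * Complex.I)‖ < 1 := by
    rw [norm_mul, Complex.norm_exp_ofReal_mul_I]
    simpa [abs_of_pos hr] using hr1
  have h := Complex.hasSum_re (Complex.hasSum_taylorSeries_neg_log hz)
  rw [← hasSum_nat_add_iff' 1] at h
  have e1 : (fun n : ℕ => r ^ (n+1) * Real.cos (((n : ℝ) + 1) * x) / ((n : ℝ) + 1)) = fun n : ℕ => (((r : ℂ) * Complex.exp (x * Complex.I)) ^ (n+1) / ((n+1 : ℕ) : ℂ)).re := by
    ext n
    have : ((r : ℂ) * Complex.exp (x * Complex.I)) ^ (n+1) / ((Nat.succ n : ℕ) : ℂ)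
        = (((r ^ (n+1) / ((n:ℝ) + 1) : ℝ)) : ℂ) * Complex.exp (((((n:ℝ) + 1) * x : ℝ) : ℂ) * Complex.I) := by
      rw [mul_pow, ← Complex.exp_nat_mul]
      push_cast
      rw [show ((n:ℂ) + 1) * (↑x * Complex.I) = ((n:ℂ) + 1) * x * Complex.I by ring]
      ring
    change _ = (((r : ℂ) * Complex.exp (x * Complex.I)) ^ (n+1) / ((Nat.succ n : ℕ) : ℂ)).re
    rw [this, Complex.re_ofReal_mul, Complex.exp_ofReal_mul_I_re]
    ring
  have e2 : -(1/2) * Real.log (1 - 2 * r * Real.cos x + r ^ 2) = (-Complex.log (1 - (r : ℂ) * Complex.exp (x * Complex.I))).re - ∑ i ∈ Finset.range 1, (((r : ℂ) * Complex.exp (x * Complex.I)) ^ i / (i : ℂ)).re := by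
    have h2 : ‖1 - (r : ℂ) * Complex.exp (x * Complex.I)‖ ^ 2 = 1 - 2 * r * Real.cos x + r ^ 2 := by
      rw [Complex.sq_norm, Complex.normSq_apply]
      simp only [Complex.sub_re, Complex.one_re, Complex.sub_im, Complex.one_im, Complex.re_ofReal_mul,
        Complex.im_ofReal_mul, Complex.exp_ofReal_mul_I_re, Complex.exp_ofReal_mul_I_im]
      linear_combination r^2 * Real.sin_sq_add_cos_sq x
    rw [← h2, Real.log_pow]
    simp [Complex.log_re]
  rw [e1, e2]
  exact h

lemma geo_deriv (r x : ℝ) (hr : 0 < r) (hr1 : r < 1) :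
    HasDerivAt (fun x : ℝ => ∑' n : ℕ, r ^ (n+1) * Real.sin (((n : ℝ) + 1) * x) / ((n : ℝ) + 1) ^ 2)
      (-(1/2) * Real.log (1 - 2 * r * Real.cos x + r ^ 2)) x := by
  rw [← (cos_series r x hr hr1).tsum_eq]
  have hs : Summable (fun n : ℕ => r ^ (n+1)) := 
    (summable_nat_add_iff 1).2 (summable_geometric_of_lt_one hr.le hr1)
  refine hasDerivAt_tsum (g := fun (n:ℕ) (x:ℝ) => r ^ (n+1) * Real.sin (((n : ℝ) + 1) * x) / ((n : ℝ) + 1) ^ 2)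
    (g' := fun (n:ℕ) (x:ℝ) => r ^ (n+1) * Real.cos (((n : ℝ) + 1) * x) / ((n : ℝ) + 1))
    hs (y₀ := 0) ?_ ?_ ?_ x
  · intro n y
    have h1 : HasDerivAt (fun x : ℝ => ((n : ℝ) + 1) * x) ((n : ℝ) + 1) y := by
      simpa using (hasDerivAt_id y).const_mul ((n : ℝ) + 1)
    have := ((h1.sin).const_mul (r ^ (n+1))).div_const (((n : ℝ) + 1) ^ 2)
    refine this.congr_deriv ?_
    field_simp
  · intro n y
    rw [norm_div, norm_mul, Real.norm_eq_abs, Real.norm_eq_abs, Real.norm_eq_abs,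
      abs_of_pos (a := ((n : ℝ) + 1)) (by positivity), abs_of_pos (a := r ^ (n+1)) (by positivity)]
    have : |Real.cos (((n:ℝ) + 1) * y)| ≤ 1 := Real.abs_cos_le_one _
    calc _ ≤ r ^ (n+1) * 1 / 1 := by
          gcongr
          linarith [Nat.cast_nonneg (α := ℝ) n]
      _ = _ := by ring
  · simpa using summable_zero

open Filter Topology Set in
lemma S2s_deriv (x : ℝ) (h0 : 0 < x) (h1 : x < 2 * Real.pi) :
    HasDerivAt S2s (-Real.log (2 * Real.sin (x/2))) x := by
  have : (𝓝[Ioo 0 1] (1:ℝ)).NeBot := mem_closure_iff_nhdsWithin_neBot.1 (by rw [closure_Ioo (by norm_num)]; simp)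
  have key := hasDerivAt_of_tendstoLocallyUniformlyOn (𝕜 := ℝ) (l := 𝓝[Ioo 0 1] (1:ℝ)) (s := Ioo 0 (2 * Real.pi))
    (f := fun (r x : ℝ) => ∑' n : ℕ, r ^ (n+1) * Real.sin (((n : ℝ) + 1) * x) / ((n : ℝ) + 1) ^ 2)
    (f' := fun (r x : ℝ) => -(1/2) * Real.log (1 - 2 * r * Real.cos x + r ^ 2))
    (g' := fun (x : ℝ) => -(1/2) * Real.log (1 - 2 * 1 * Real.cos x + 1 ^ 2))
    (g := S2s) (x := x) isOpen_Ioo ?_ ?_ ?_ ⟨h0, h1⟩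
  · refine key.congr_deriv ?_
    have hsin : 0 < Real.sin (x/2) := Real.sin_pos_of_pos_of_lt_pi (by linarith) (by linarith)
    have : 1 - 2 * 1 * Real.cos x + 1 ^ 2 = (2 * Real.sin (x/2)) ^ 2 := by
      have := Real.cos_two_mul (x/2)
      have h4 := Real.sin_sq_add_cos_sq (x/2)
      rw [show 2 * (x/2) = x by ring] at this
      linarith
    rw [this, Real.log_pow]
    push_cast
    ring
  · rw [tendstoLocallyUniformlyOn_iff_forall_isCompact isOpen_Ioo]
    intro K hK hKc u hu
    have hcont : ContinuousOn (Function.uncurry fun (r x : ℝ) =>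
        -(1/2) * Real.log (1 - 2 * r * Real.cos x + r ^ 2)) (Ioc (0:ℝ) 1 ×ˢ K) := by
      rintro ⟨r, y⟩ ⟨hr, hy⟩
      have hp := pos_aux r y hr.1 (hK hy).1 (hK hy).2
      apply ContinuousAt.continuousWithinAt
      simp only [Function.uncurry_def]
      refine ContinuousAt.mul (by fun_prop) (ContinuousAt.log (by fun_prop) hp.ne')
    obtain ⟨v, hv, hv2⟩ := hKc.mem_uniformity_of_prod hcont (q := 1) (by simp) (symm_le_uniformity hu)
    have : 𝓝[Ioo 0 1] (1:ℝ) ≤ 𝓝[Ioc 0 1] (1:ℝ) := nhdsWithin_mono _ Ioo_subset_Ioc_self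
    filter_upwards [this hv] with r hr y hy
    exact hv2 r hr y hy
  · filter_upwards [self_mem_nhdsWithin] with r hr y hy
    exact geo_deriv r y hr.1 hr.2
  · intro y hy
    refine tendsto_tsum_of_dominated_convergence (aux_sum 2 (by norm_num)) ?_ ?_
    · intro n
      have : Continuous (fun r : ℝ => r ^ (n+1) * Real.sin (((n : ℝ) + 1) * y) / ((n : ℝ) + 1) ^ 2) := by fun_prop
      have := this.tendsto 1
      simp only [one_pow, one_mul] at this
      exact this.mono_left nhdsWithin_le_nhds
    · filter_upwards [self_mem_nhdsWithin] with r hr n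
      rw [norm_div, norm_mul, Real.norm_eq_abs, Real.norm_eq_abs, Real.norm_eq_abs,
        abs_of_pos (a := ((n : ℝ) + 1)^2) (by positivity), abs_of_pos (a := r ^ (n+1)) (pow_pos hr.1 _)]
      gcongr
      exact mul_le_one₀ (pow_le_one₀ hr.1.le hr.2.le) (abs_nonneg _) (Real.abs_sin_le_one _)

lemma zetaR_nonneg (m : ℕ) : 0 ≤ zetaR m := tsum_nonneg fun n => by positivity

lemma zetaR_le (m : ℕ) (hm : 2 ≤ m) : zetaR m ≤ zetaR 2 := by
  refine Summable.tsum_le_tsum (fun n => ?_) (aux_sum m hm) (aux_sum 2 le_rfl)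
  gcongr
  linarith [Nat.cast_nonneg (α := ℝ) n]

noncomputable def bco (n : ℕ) : ℝ := Babs (n + 1) / (2 * ((n : ℝ) + 1))

noncomputable def Pj (j : ℕ) (x : ℝ) : ℝ :=
  ∑' n : ℕ, bco n * x ^ (2 * n + j) / (Nat.factorial (2 * n + j))

lemma bco_eq (n : ℕ) : bco n / (Nat.factorial (2 * n + 2)) =
    zetaR (2 * n + 2) / (2 * Real.pi) ^ (2 * n + 2) / ((n : ℝ) + 1) := by
  have : (Nat.factorial (2 * n + 2) : ℝ) ≠ 0 := by positivity
  unfold bco Babs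
  rw [show 2 * (n + 1) = 2 * n + 2 by ring]
  field_simp

lemma bco_nonneg (n : ℕ) : 0 ≤ bco n := by
  have := zetaR_nonneg (2 * (n+1))
  unfold bco Babs
  positivity

lemma bco_bound (n j : ℕ) (hj : 2 ≤ j) : bco n / (Nat.factorial (2 * n + j)) ≤
    zetaR 2 / (2 * Real.pi) ^ (2 * n + 2) := by
  have h1 : bco n / (Nat.factorial (2 * n + j)) ≤ bco n / (Nat.factorial (2 * n + 2)) := by
    have := bco_nonneg n
    gcongr
  refine h1.trans ?_
  rw [bco_eq]
  have h2 := zetaR_le (2 * n + 2) (by omega)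
  have h3 := zetaR_nonneg 2
  calc _ ≤ zetaR 2 / (2 * Real.pi) ^ (2 * n + 2) / 1 := by
        gcongr
        linarith [Nat.cast_nonneg (α := ℝ) n]
    _ = _ := by ring

lemma term_bound (n j : ℕ) (hj : 2 ≤ j) (x ρ : ℝ) (hx : |x| ≤ ρ) :
    ‖bco n * x ^ (2 * n + j) / (Nat.factorial (2 * n + j))‖ ≤
      zetaR 2 / (2 * Real.pi) ^ (2 * n + 2) * ρ ^ (2 * n + j) := by
  have h1 := bco_bound n j hj
  have h2 := bco_nonneg n
  have : bco n * x ^ (2 * n + j) / (Nat.factorial (2 * n + j))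
    = bco n / (Nat.factorial (2 * n + j)) * x ^ (2 * n + j) := by ring
  rw [this, norm_mul, Real.norm_eq_abs, Real.norm_eq_abs, abs_of_nonneg (by positivity), abs_pow]
  have h3 := zetaR_nonneg 2
  gcongr

lemma bound_summable (j : ℕ) (ρ : ℝ) (h0 : 0 ≤ ρ) (h1 : ρ < 2 * Real.pi) :
    Summable fun n : ℕ => zetaR 2 / (2 * Real.pi) ^ (2 * n + 2) * ρ ^ (2 * n + j) := by
  have hpi := Real.pi_pos
  have hq : ρ / (2 * Real.pi) < 1 := by rw [div_lt_one (by positivity)]; exact h1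
  have hq0 : 0 ≤ ρ / (2 * Real.pi) := by positivity
  have h := (summable_geometric_of_lt_one (r := (ρ / (2 * Real.pi)) ^ 2) (by positivity)
    (pow_lt_one₀ hq0 hq (by norm_num))).mul_left (zetaR 2 * ρ ^ j / (2 * Real.pi) ^ 2)
  refine h.congr fun n => ?_
  rw [← pow_mul, div_pow, pow_add, pow_add]
  field_simp

lemma Pj_deriv (j : ℕ) (hj : 2 ≤ j) (x : ℝ) (hx : |x| < 2 * Real.pi) :
    HasDerivAt (Pj (j+1)) (Pj j x) x := by
  obtain ⟨ρ, h1, h2⟩ := exists_between hx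
  have h0 : 0 < ρ := lt_of_le_of_lt (abs_nonneg _) h1
  refine hasDerivAt_tsum_of_isPreconnected (t := Set.Ioo (-ρ) ρ) (y₀ := 0) (y := x)
    (g := fun (n : ℕ) (x : ℝ) => bco n * x ^ (2 * n + (j+1)) / (Nat.factorial (2 * n + (j+1))))
    (g' := fun (n : ℕ) (x : ℝ) => bco n * x ^ (2 * n + j) / (Nat.factorial (2 * n + j)))
    (bound_summable j ρ h0.le h2) isOpen_Ioo isPreconnected_Ioo ?_ ?_ ?_ ?_ ?_
  · intro n y _
    have := (((hasDerivAt_pow (2 * n + (j+1)) y).const_mul (bco n)).div_const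
      (Nat.factorial (2 * n + (j+1)) : ℝ))
    refine this.congr_deriv ?_
    rw [show 2 * n + (j+1) = (2 * n + j) + 1 by ring, Nat.factorial_succ]
    have : (Nat.factorial (2 * n + j) : ℝ) ≠ 0 := by positivity
    have : (((2 * n + j + 1 : ℕ)) : ℝ) ≠ 0 := by positivity
    rw [Nat.add_sub_cancel]
    push_cast at *
    field_simp
  · intro n y hy
    exact term_bound n j hj y ρ (abs_le.2 ⟨hy.1.le, hy.2.le⟩)
  · exact ⟨by linarith, h0⟩
  · simpa using summable_zero
  · exact abs_lt.1 h1

lemma Pj_zero (j : ℕ) (hj : 1 ≤ j) : Pj j 0 = 0 := by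
  unfold Pj
  have : ∀ n : ℕ, (0:ℝ) ^ (2 * n + j) = 0 := fun n => zero_pow (by omega)
  simp [this]

lemma P2_eq (x : ℝ) (h0 : 0 < x) (h1 : x < 2 * Real.pi) :
    Pj 2 x = Real.log x - Real.log (2 * Real.sin (x/2)) := by
  have hpi := Real.pi_pos
  set t := x / (2 * Real.pi) with ht
  have ht0 : 0 < t := by positivity
  have ht1 : t < 1 := by rw [ht, div_lt_one (by positivity)]; exact h1
  let F : ℕ → ℕ → ℝ := fun n k => (t ^ 2 / ((k:ℝ) + 1) ^ 2) ^ (n+1) / ((n:ℝ) + 1)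
  have hF0 : ∀ n k, 0 ≤ F n k := fun n k => by positivity
  have hFe : ∀ n k, F n k = t ^ (2 * n + 2) / ((n:ℝ) + 1) * (1 / ((k:ℝ) + 1) ^ (2 * n + 2)) := by
    intro n k
    simp only [F]
    rw [div_pow, ← pow_mul, ← pow_mul, show 2 * (n+1) = 2 * n + 2 by ring]
    field_simp
  have hFn : ∀ n, Summable (F n) := fun n => by
    refine ((aux_sum (2 * n + 2) (by omega)).mul_left (t ^ (2 * n + 2) / ((n:ℝ) + 1))).congr ?_
    intro k
    exact (hFe n k).symm
  have hFt : ∀ n, ∑' k, F n k = bco n * x ^ (2 * n + 2) / (Nat.factorial (2 * n + 2)) := fun n => by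
    simp_rw [hFe]
    rw [tsum_mul_left]
    change _ * zetaR (2 * n + 2) = _
    rw [mul_div_right_comm, bco_eq, ht, div_pow]
    field_simp
  have hsum : Summable fun n => ∑' k, F n k := by
    simp_rw [hFt]
    exact Summable.of_norm_bounded (bound_summable 2 x h0.le h1)
      (fun n => term_bound n 2 le_rfl x x (abs_of_pos h0).le)
  have hS : Summable (Function.uncurry F) :=
    (summable_prod_of_nonneg (f := Function.uncurry F) (fun p => hF0 p.1 p.2)).2 ⟨hFn, hsum⟩
  have hlt : ∀ k : ℕ, t ^ 2 / ((k:ℝ) + 1) ^ 2 < 1 := fun k => by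
    rw [div_lt_one (by positivity)]
    have : (1:ℝ) ≤ (k:ℝ) + 1 := by linarith [Nat.cast_nonneg (α := ℝ) k]
    exact pow_lt_pow_left₀ (by linarith) ht0.le (by norm_num)
  have hk : ∀ k : ℕ, ∑' n, F n k = -Real.log (1 - t ^ 2 / ((k:ℝ) + 1) ^ 2) := fun k =>
    (Real.hasSum_pow_div_log_of_abs_lt_one (by
      rw [abs_of_nonneg (by positivity)]; exact hlt k)).tsum_eq
  have hP : Pj 2 x = ∑' k : ℕ, -Real.log (1 - t ^ 2 / ((k:ℝ) + 1) ^ 2) := by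
    unfold Pj
    simp_rw [← hFt, ← hk]
    exact hS.tsum_comm.symm
  have hsk : Summable fun k : ℕ => -Real.log (1 - t ^ 2 / ((k:ℝ) + 1) ^ 2) := by
    simp_rw [← hk]
    exact hS.prod_symm.prod
  have hlim := hsk.hasSum.tendsto_sum_nat
  have hsin : 0 < Real.sin (x/2) := Real.sin_pos_of_pos_of_lt_pi (by linarith) (by linarith)
  have hpt : Real.pi * t = x / 2 := by rw [ht]; field_simp
  have hE := Real.tendsto_euler_sin_prod t
  rw [hpt] at hE
  have hE2 := (hE.log hsin.ne').const_sub (Real.log (x/2))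
  have hcongr : (fun n : ℕ => Real.log (x/2) - Real.log (x / 2 * ∏ j ∈ Finset.range n, (1 - t ^ 2 / ((j:ℝ) + 1) ^ 2)))
      = fun n : ℕ => ∑ k ∈ Finset.range n, -Real.log (1 - t ^ 2 / ((k:ℝ) + 1) ^ 2) := by
    ext n
    have hne : ∀ k ∈ Finset.range n, 1 - t ^ 2 / ((k:ℝ) + 1) ^ 2 ≠ 0 := fun k _ =>
      (sub_pos.2 (hlt k)).ne'
    rw [Real.log_mul (by positivity) (Finset.prod_ne_zero_iff.2 hne), Real.log_prod hne,
      Finset.sum_neg_distrib]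
    ring
  rw [hcongr] at hE2
  rw [hP, tendsto_nhds_unique hlim hE2, Real.log_div h0.ne' (by norm_num),
    Real.log_mul (by norm_num) hsin.ne']
  ring

lemma zero_step (f f' : ℝ → ℝ) (c : ℝ) (hc : ContinuousOn f (Set.Ico 0 c))
    (hd : ∀ x, 0 < x → x < c → HasDerivAt f (f' x) x) (hz : ∀ x, 0 < x → x < c → f' x = 0)
    (h0 : f 0 = 0) (x : ℝ) (hx0 : 0 < x) (hx : x < c) : f x = 0 := by
  obtain ⟨y, hy, hy2⟩ := exists_hasDerivAt_eq_slope f f' hx0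
    (hc.mono fun z hz => ⟨hz.1, hz.2.trans_lt hx⟩) (fun z hz => hd z hz.1 (hz.2.trans hx))
  rw [hz y hy.1 (hy.2.trans hx), h0, eq_comm, div_eq_zero_iff] at hy2
  rcases hy2 with h | h <;> linarith

lemma Pj_cont (j : ℕ) (hj : 2 ≤ j) : ContinuousOn (Pj (j+1)) (Set.Ico 0 (2 * Real.pi)) := by
  intro y hy
  exact (Pj_deriv j hj y (by rw [abs_of_nonneg hy.1]; exact hy.2)).continuousAt.continuousWithinAt

lemma D2_zero (x : ℝ) (h0 : 0 < x) (h1 : x < 2 * Real.pi) :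
    -S2s x - (x * Real.log x - x - Pj 3 x) = 0 := by
  refine zero_step (fun x => -S2s x - (x * Real.log x - x - Pj 3 x))
    (fun x => -(-Real.log (2 * Real.sin (x/2))) - ((1 * Real.log x + x * x⁻¹) - 1 - Pj 2 x)) (2 * Real.pi)
    ?_ ?_ ?_ ?_ x h0 h1
  · exact (S2s_cont.neg.continuousOn).sub
      ((Real.continuous_mul_log.continuousOn.sub continuousOn_id).sub (Pj_cont 2 le_rfl))
  · intro x h0 h1
    exact (S2s_deriv x h0 h1).neg.sub ((((hasDerivAt_id x).mul (Real.hasDerivAt_log h0.ne')).sub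
      (hasDerivAt_id x)).sub (Pj_deriv 2 le_rfl x (by rw [abs_of_pos h0]; exact h1)))
  · intro x h0 h1
    rw [P2_eq x h0 h1, mul_inv_cancel₀ h0.ne']
    ring
  · simp [Pj_zero, S2s]

lemma D1_zero (x : ℝ) (h0 : 0 < x) (h1 : x < 2 * Real.pi) :
    S3c x - (zetaR 3 + x ^ 2 / 2 * Real.log x - 3 / 4 * x ^ 2 - Pj 4 x) = 0 := by
  refine zero_step (fun x => S3c x - (zetaR 3 + x ^ 2 / 2 * Real.log x - 3 / 4 * x ^ 2 - Pj 4 x))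
    (fun x => -S2s x - (x * Real.log x - x - Pj 3 x)) (2 * Real.pi)
    ?_ ?_ D2_zero ?_ x h0 h1
  · have hc : Continuous S3c := continuous_iff_continuousAt.2 fun x => (S3c_deriv x).continuousAt
    have hl : Continuous fun x : ℝ => x ^ 2 / 2 * Real.log x := by
      have := (continuous_id.div_const (2:ℝ)).mul Real.continuous_mul_log
      refine this.congr fun x => ?_
      simp only [id, Pi.mul_apply, Pi.pow_apply]; ring
    exact hc.continuousOn.sub
      (((continuous_const.add hl).continuousOn.sub (by fun_prop)).sub (Pj_cont 3 (by norm_num)))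
  · intro x h0 h1
    have := (S3c_deriv x).sub ((((((hasDerivAt_pow 2 x).div_const 2).mul (Real.hasDerivAt_log h0.ne')).const_add (zetaR 3)).sub
      ((hasDerivAt_pow 2 x).const_mul (3/4))).sub (Pj_deriv 3 (by norm_num) x (by rw [abs_of_pos h0]; exact h1)))
    refine this.congr_deriv ?_
    push_cast
    field_simp
    ring
  · simp [Pj_zero, S3c, zetaR]

lemma D0_zero (x : ℝ) (h0 : 0 < x) (h1 : x < 2 * Real.pi) :
    S4 x - (x * zetaR 3 + x ^ 3 / 6 * Real.log x - 11 / 36 * x ^ 3 - Pj 5 x) = 0 := by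
  refine zero_step (fun x => S4 x - (x * zetaR 3 + x ^ 3 / 6 * Real.log x - 11 / 36 * x ^ 3 - Pj 5 x))
    (fun x => S3c x - (zetaR 3 + x ^ 2 / 2 * Real.log x - 3 / 4 * x ^ 2 - Pj 4 x)) (2 * Real.pi)
    ?_ ?_ D1_zero ?_ x h0 h1
  · have hc : Continuous S4 := continuous_iff_continuousAt.2 fun x => (S4_deriv x).continuousAt
    have hl : Continuous fun x : ℝ => x ^ 3 / 6 * Real.log x := by
      have := ((continuous_id.pow 2).div_const (6:ℝ)).mul Real.continuous_mul_log
      refine this.congr fun x => ?_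
      simp only [id, Pi.mul_apply, Pi.pow_apply]; ring
    exact hc.continuousOn.sub
      ((((continuous_id.mul continuous_const).add hl).continuousOn.sub (by fun_prop)).sub (Pj_cont 4 (by norm_num)))
  · intro x h0 h1
    have := (S4_deriv x).sub (((((hasDerivAt_id x).mul_const (zetaR 3)).add
      (((hasDerivAt_pow 3 x).div_const 6).mul (Real.hasDerivAt_log h0.ne'))).sub
      ((hasDerivAt_pow 3 x).const_mul (11/36))).sub (Pj_deriv 4 (by norm_num) x (by rw [abs_of_pos h0]; exact h1)))
    refine this.congr_deriv ?_
    push_cast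
    field_simp
    ring
  · simp [Pj_zero, S4]

/-- For `0 < x < 2π`,
`S_4(x) = x·ζ(3) + (x^3/6)·log x − (11/36)·x^3 − (x^5/2) Σ_{n≥0} |B(2n+2)| x^{2n}/((n+1)(2n+5)!)`. -/
theorem S4_series_representation :
    ∀ x : ℝ, 0 < x → x < 2 * Real.pi →
      S4 x = x * zetaR 3 + (x ^ 3 / 6) * Real.log x - (11 / 36) * x ^ 3
        - (x ^ 5 / 2) *
            ∑' n : ℕ, Babs (n + 1) * x ^ (2 * n)
              / (((n : ℝ) + 1) * (Nat.factorial (2 * n + 5))) := by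
  intro x h0 h1
  have h := D0_zero x h0 h1
  have hP : Pj 5 x = (x ^ 5 / 2) * ∑' n : ℕ, Babs (n + 1) * x ^ (2 * n)
              / (((n : ℝ) + 1) * (Nat.factorial (2 * n + 5))) := by
    unfold Pj bco
    rw [← tsum_mul_left]
    refine tsum_congr fun n => ?_
    have : (Nat.factorial (2 * n + 5) : ℝ) ≠ 0 := by positivity
    rw [pow_add]
    field_simp
  rw [← hP]
  linarith
end
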